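/- arXiv:2510.11311 — 4 statements merged into one kernel-verified Lean document; each statement's English description precedes it below -/
import Mathlib

section
/- For all positive integers k ≥ 2, d and t, there exists a layered rooted digraph D in which every vertex not in the bottom layer has out-degree exactly d, with the following property: whenever H is a subdigraph of D containing the root such that every vertex of H not in the bottom layer of D has out-degree at least k in H, then H has an induced subdigraph with non-empty vertex set, contained entirely in the bottom t layers of D, in which every vertex has both in-degree and out-degree at least k, except that the vertices lying in the first layer from the bottom have out-degree zero and the vertices lying in the t-th layer from the bottom have in-degree zero. -/
/-- A digraph: a set of vertices together with arcs (ordered pairs of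
distinct vertices) between them, inside an ambient vertex type `α`. -/
structure Digraph' (α : Type) where
  verts : Set α
  Adj : α → α → Prop
  ne_of_adj : ∀ ⦃u v : α⦄, Adj u v → u ≠ v
  mem_verts_left : ∀ ⦃u v : α⦄, Adj u v → u ∈ verts
  mem_verts_right : ∀ ⦃u v : α⦄, Adj u v → v ∈ verts

namespace Digraph'

variable {α β : Type}

/-- The out-neighbourhood of a vertex. -/
def outNbrs (D : Digraph' α) (v : α) : Set α := {u | D.Adj v u}

/-- The in-neighbourhood of a vertex. -/
def inNbrs (D : Digraph' α) (v : α) : Set α := {u | D.Adj u v}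

/-- The set `s` has at least `k` elements (also meaningful for infinite sets). -/
def AtLeast (s : Set α) (k : ℕ) : Prop := ∃ t : Finset α, ↑t ⊆ s ∧ k ≤ t.card

/-- Every vertex of `D` has out-degree at least `k`, i.e. `δ⁺(D) ≥ k`. -/
def MinOutDegAtLeast (D : Digraph' α) (k : ℕ) : Prop :=
  ∀ v ∈ D.verts, AtLeast (D.outNbrs v) k

/-- `D'` is a subdigraph of `D`. -/
def IsSubdigraph (D' D : Digraph' α) : Prop :=
  D'.verts ⊆ D.verts ∧ ∀ ⦃u v : α⦄, D'.Adj u v → D.Adj u v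

/-- `D` contains a copy of the pattern digraph `F` (a pattern digraph has
vertex set all of its ambient type). -/
def HasCopy (D : Digraph' α) (F : Digraph' β) : Prop :=
  ∃ f : β → α, Function.Injective f ∧ (∀ w : β, f w ∈ D.verts) ∧
    ∀ ⦃u v : β⦄, F.Adj u v → D.Adj (f u) (f v)

/-- The digraph `F` is avoidable: there is `d_F : ℕ → ℕ` such that every
(nonempty) digraph of minimum out-degree at least `d_F k` contains an
`F`-free subdigraph of minimum out-degree at least `k`. -/
def Avoidable (F : Digraph' β) : Prop :=
  ∃ dF : ℕ → ℕ, ∀ (α : Type) (D : Digraph' α) (k : ℕ), D.verts.Nonempty →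
    D.MinOutDegAtLeast (dF k) →
    ∃ D' : Digraph' α, D'.IsSubdigraph D ∧ D'.verts.Nonempty ∧
      D'.MinOutDegAtLeast k ∧ ¬ D'.HasCopy F

end Digraph'

open Digraph'

/-- There is a directed walk of length `n` from `u` to `v` in `D`. -/
def WalkOfLen {α : Type} (D : Digraph' α) : α → α → ℕ → Prop
  | u, v, 0 => u = v ∧ v ∈ D.verts
  | u, v, n + 1 => ∃ w : α, D.Adj u w ∧ WalkOfLen D w v n

/-- The `i`-th layer of the digraph `D` rooted at `r`: the vertices at
directed distance exactly `i` from `r`. -/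
def layerSet {α : Type} (D : Digraph' α) (r : α) (i : ℕ) : Set α :=
  {v | WalkOfLen D r v i ∧ ∀ j, j < i → ¬ WalkOfLen D r v j}


/-- Auxiliary: ranked graphs with `d` labelled out-arcs; `lev` is the height above the bottom. -/
structure LG (d : ℕ) where
  V : Type
  lev : V → ℕ
  out : V → Fin d → V
  lev_out : ∀ v i, lev v ≠ 0 → lev (out v i) + 1 = lev v
  inj : ∀ v, lev v ≠ 0 → Function.Injective (out v)
  root : V

/-- The forcing property with a colouring of the bottom layer. -/
def LG.Force {d : ℕ} (G : LG d) (k t : ℕ) (κ : Type) : Prop :=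
  ∀ (P : Set G.V) (c : G.V → Finset (Fin d)) (col : G.V → κ), G.root ∈ P →
    (∀ v ∈ P, G.lev v ≠ 0 → k ≤ (c v).card ∧ ∀ i ∈ c v, G.out v i ∈ P) →
    ∃ S : Set G.V, S ⊆ P ∧
      (∀ v ∈ S, G.lev v < t ∧ (G.lev v ≠ 0 → ∀ i ∈ c v, G.out v i ∈ S) ∧
        (G.lev v + 1 ≠ t →
          AtLeast {u | u ∈ S ∧ G.lev u ≠ 0 ∧ ∃ i ∈ c u, G.out u i = v} k)) ∧
      (∃ a, ∀ v ∈ S, G.lev v = 0 → col v = a) ∧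
      AtLeast {v | v ∈ S ∧ G.lev v = 0} k

/-- The `d`-ary tree. -/
def treeLG (d n : ℕ) : LG d where
  V := ℕ × List (Fin d)
  lev v := v.1
  out v i := (v.1 - 1, i :: v.2)
  lev_out v i h := by simp only; omega
  inj v h := by
    intro i j hij
    simp at hij
    exact hij
  root := (n, [])

theorem treeLG_force (d k : ℕ) (hk : 2 ≤ k) (κ : Type) [Fintype κ]
    (n : ℕ) (hn : n = k * Fintype.card κ) : (treeLG d n).Force k 1 κ := by
  classical
  intro (P : Set (ℕ × List (Fin d))) (c : ℕ × List (Fin d) → Finset (Fin d))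
    (col : ℕ × List (Fin d) → κ) (hr : (n, []) ∈ P)
    (hP : ∀ v ∈ P, v.1 ≠ 0 → k ≤ (c v).card ∧ ∀ i ∈ c v, (v.1 - 1, i :: v.2) ∈ P)
  have key : ∀ j, j ≤ n → ∃ s : Finset (List (Fin d)), 2 ^ j ≤ s.card ∧
      ∀ p ∈ s, ((n - j, p) : ℕ × List (Fin d)) ∈ P := by
    intro j
    induction j with
    | zero => intro _; exact ⟨{[]}, by simp, by simpa using hr⟩
    | succ j ih =>
      intro hj
      obtain ⟨s, hs, hsP⟩ := ih (by omega)
      let S := s.sigma (fun p => c (n - j, p))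
      refine ⟨S.image (fun x => x.2 :: x.1), ?_, ?_⟩
      · rw [Finset.card_image_of_injective]
        · rw [Finset.card_sigma]
          have : ∑ p ∈ s, 2 ≤ ∑ p ∈ s, (c (n - j, p)).card := by
            refine Finset.sum_le_sum fun p hp => ?_
            exact hk.trans (hP _ (hsP p hp) (by simp only; omega)).1
          simp at this
          rw [pow_succ]; omega
        · rintro ⟨a, b⟩ ⟨a', b'⟩ h
          simp at h
          obtain ⟨rfl, rfl⟩ := h
          rfl
      · intro p hp
        simp only [Finset.mem_image, S, Finset.mem_sigma] at hp
        obtain ⟨⟨q, i⟩, ⟨hq, hi⟩, rfl⟩ := hp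
        have := (hP _ (hsP q hq) (by simp only; omega)).2 i hi
        simpa [Nat.sub_sub] using this
  obtain ⟨s, hs, hsP⟩ := key n le_rfl
  have : Nonempty κ := ⟨col (0, [])⟩
  have h2 : Fintype.card κ * k ≤ s.card := by
    have := Nat.lt_two_pow_self (n := n)
    rw [mul_comm]; omega
  obtain ⟨a, -, ha⟩ := Finset.exists_le_card_fiber_of_mul_le_card_of_maps_to
    (s := s) (t := Finset.univ) (f := fun p => col ((0, p) : ℕ × List (Fin d))) (n := k)
    (fun _ _ => Finset.mem_univ _) Finset.univ_nonempty (by simpa using h2)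
  let S : Set (ℕ × List (Fin d)) := {v | v ∈ P ∧ v.1 = 0 ∧ col v = a}
  have hSc : AtLeast {v | v ∈ S ∧ v.1 = 0} k := by
    refine ⟨(s.filter (fun p => col ((0, p) : ℕ × List (Fin d)) = a)).image
      (fun p => ((0, p) : ℕ × List (Fin d))), ?_, ?_⟩
    · intro v hv
      simp only [Finset.coe_image, Set.mem_image, Finset.mem_coe, Finset.mem_filter] at hv
      obtain ⟨p, ⟨hp, hpa⟩, rfl⟩ := hv
      have := hsP p hp
      simp only [Nat.sub_self] at this
      exact ⟨⟨this, rfl, hpa⟩, rfl⟩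
    · rw [Finset.card_image_of_injective]
      · exact ha
      · intro p q h
        simpa using h
  refine ⟨S, fun v hv => hv.1, ?_, ⟨a, fun v hv _ => hv.2.2⟩, hSc⟩
  rintro v ⟨h1, h2, h3⟩
  have : (treeLG d n).lev v = 0 := h2
  rw [this]
  simp

/-- `leaf` is a labelling of the depth `n` tree so that every `k`-branching subtree meets
a leaf which is good for `w`. -/
def Wins {d : ℕ} (k : ℕ) {E : Type} (n : ℕ) (leaf : List (Fin d) → E) (good : E → Prop) : Prop :=
  ∀ Q : List (Fin d) → Prop, Q [] →
    (∀ p, p.length < n → Q p → ∃ s : Finset (Fin d), k ≤ s.card ∧ ∀ i ∈ s, Q (i :: p)) →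
    ∃ p, p.length = n ∧ Q p ∧ good (leaf p)

/-- join trees -/
def joinLeaf {d : ℕ} {E : Type} (e : E) (f : Fin d → List (Fin d) → E) (p : List (Fin d)) : E :=
  match p.getLast? with
  | none => e
  | some i => f i p.dropLast

theorem Wins.join {d k n : ℕ} (hk : 2 ≤ k) {E : Type} (e : E) (f : Fin d → List (Fin d) → E)
    (good : E → Prop) (h : ∀ i j, ¬ Wins k n (f i) good → ¬ Wins k n (f j) good → i = j) :
    Wins k (n + 1) (joinLeaf e f) good := by
  intro Q h0 hQ
  obtain ⟨s, hs, hsQ⟩ := hQ [] (by simp) h0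
  have : ∃ i ∈ s, Wins k n (f i) good := by
    by_contra hcon
    push Not at hcon
    have : s.card ≤ 1 := Finset.card_le_one.2 fun a ha b hb => h a b (hcon a ha) (hcon b hb)
    omega
  obtain ⟨i, hi, hw⟩ := this
  obtain ⟨p, hp, hQp, hg⟩ := hw (fun l => Q (l ++ [i])) (hsQ i hi) (by
    intro p hp hq
    obtain ⟨s, hs, hs'⟩ := hQ (p ++ [i]) (by simpa using hp) hq
    exact ⟨s, hs, fun j hj => by simpa using hs' j hj⟩)
  refine ⟨p ++ [i], by simp [hp], hQp, ?_⟩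
  simpa [joinLeaf] using hg

theorem Wins.pad {d k n : ℕ} (hk : 2 ≤ k) {E : Type} (e : E) (W : Set (E → Prop))
    (h : ∃ leaf : List (Fin d) → E, ∀ good ∈ W, Wins k n leaf good) (m : ℕ) (hm : n ≤ m) :
    ∃ leaf : List (Fin d) → E, ∀ good ∈ W, Wins k m leaf good := by
  induction m, hm using Nat.le_induction with
  | base => exact h
  | succ m hm ih =>
    obtain ⟨leaf, hl⟩ := ih
    exact ⟨joinLeaf e (fun _ => leaf), fun g hg =>
      Wins.join hk e _ g fun i j hi => absurd (hl g hg) hi⟩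

theorem exists_wins {d k : ℕ} (hd : 1 ≤ d) (hk : 2 ≤ k) {E X : Type} (good : X → E → Prop)
    (hbase : ∀ W : Finset X, W.card < d → ∃ e, ∀ w ∈ W, good w e) (W : Finset X) :
    ∃ (n : ℕ) (leaf : List (Fin d) → E), ∀ w ∈ W, Wins k n leaf (good w) := by
  classical
  induction hc : W.card using Nat.strong_induction_on generalizing W with
  | _ N ih =>
  by_cases hW : W.card < d
  · obtain ⟨e, he⟩ := hbase W hW
    exact ⟨0, fun _ => e, fun w hw Q h0 _ => ⟨[], rfl, h0, he w hw⟩⟩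
  · obtain ⟨e, -⟩ := hbase ∅ (by rw [Finset.card_empty]; omega)
    obtain ⟨T, hTW, hT⟩ := Finset.exists_subset_card_eq (not_lt.1 hW)
    let x := T.equivFinOfCardEq hT
    have hx : ∀ i, ((x.symm i : T) : X) ∈ W := fun i => hTW (x.symm i).2
    have hi : ∀ i : Fin d, ∃ (n : ℕ) (leaf : List (Fin d) → E),
        ∀ w ∈ W.erase (x.symm i), Wins k n leaf (good w) := by
      intro i
      refine ih _ ?_ (W.erase (x.symm i)) rfl
      rw [← hc]
      exact Finset.card_erase_lt_of_mem (hx i)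
    choose n hn using hi
    let M := Finset.univ.sup n
    have hi2 : ∀ i : Fin d, ∃ (leaf : List (Fin d) → E),
        ∀ g ∈ (good '' (W.erase (x.symm i) : Finset X)), Wins k M leaf g := by
      intro i
      refine Wins.pad (n := n i) hk e _ ?_ M (Finset.le_sup (Finset.mem_univ i))
      obtain ⟨leaf, hl⟩ := hn i
      refine ⟨leaf, ?_⟩
      rintro g ⟨w, hw, rfl⟩
      exact hl w hw
    choose f hf using hi2
    refine ⟨M + 1, joinLeaf e f, fun w hw => Wins.join hk e f _ ?_⟩
    have aux : ∀ i, ¬ Wins k M (f i) (good w) → ((x.symm i : T) : X) = w := by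
      intro i hnot
      by_contra hne
      exact hnot (hf i _ ⟨w, Finset.mem_coe.2 (Finset.mem_erase.2 ⟨fun h => hne h.symm, hw⟩), rfl⟩)
    intro i j h1 h2
    have := (aux i h1).trans (aux j h2).symm
    exact x.symm.injective (Subtype.ext this)

theorem mono_set (d : ℕ) (κ : Type) [Fintype κ] :
    ∃ N : ℕ, ∀ W : Finset (Fin N → κ), W.card < d →
      ∃ e : Fin d ↪ Fin N, ∀ w ∈ W, ∃ a, ∀ i, w (e i) = a := by
  classical
  obtain ⟨N, hN⟩ : ∃ N, N = (Fintype.card κ + 1) ^ d * d + 1 := ⟨_, rfl⟩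
  refine ⟨N, fun W hW => ?_⟩
  have hcard : Fintype.card (W → κ) * d < Fintype.card (Fin N) := by
    rw [Fintype.card_fin, Fintype.card_fun, Fintype.card_coe]
    have : Fintype.card κ ^ W.card ≤ (Fintype.card κ + 1) ^ d :=
      (Nat.pow_le_pow_left (Nat.le_succ _) _).trans
        (Nat.pow_le_pow_right (Nat.succ_pos _) hW.le)
    have := Nat.mul_le_mul_right d this
    omega
  obtain ⟨y, hy⟩ := Fintype.exists_lt_card_fiber_of_mul_lt_card
    (f := fun (b : Fin N) (w : W) => w.1 b) hcard
  obtain ⟨T, hT, hTc⟩ := Finset.exists_subset_card_eq hy.le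
  let x := T.equivFinOfCardEq hTc
  refine ⟨x.symm.toEmbedding.trans (Function.Embedding.subtype _), fun w hw => ⟨y ⟨w, hw⟩, ?_⟩⟩
  intro i
  have := hT (x.symm i).2
  simp only [Finset.mem_filter] at this
  exact congrFun this.2 ⟨w, hw⟩

/-- place a tree node -/
def place {d : ℕ} (G : LG d) (N n : ℕ) (p : List (Fin d)) :
    (ℕ × List (Fin d)) ⊕ ((List (Fin d) × G.V) ⊕ Fin N) :=
  match n with
  | 0 => Sum.inr (Sum.inl (p, G.root))
  | n + 1 => Sum.inl (n, p)

/-- The inductive step. -/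
def stepLG {d : ℕ} (G : LG d) (N n : ℕ) (leaf : List (Fin d) → (Fin d ↪ Fin N)) : LG d where
  V := (ℕ × List (Fin d)) ⊕ ((List (Fin d) × G.V) ⊕ Fin N)
  lev
    | Sum.inl x => x.1 + 1 + (G.lev G.root + 1)
    | Sum.inr (Sum.inl x) => G.lev x.2 + 1
    | Sum.inr (Sum.inr _) => 0
  out
    | Sum.inl x => fun i => place G N x.1 (i :: x.2)
    | Sum.inr (Sum.inl x) => fun i =>
        if G.lev x.2 = 0 then Sum.inr (Sum.inr (leaf x.1 i))
        else Sum.inr (Sum.inl (x.1, G.out x.2 i))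
    | Sum.inr (Sum.inr b) => fun _ => Sum.inr (Sum.inr b)
  lev_out := by
    rintro (⟨n, p⟩ | ⟨p, v⟩ | b) i h
    · cases n <;> simp [place] <;> omega
    · by_cases hv : G.lev v = 0
      · simp [hv]
      · simpa [hv] using G.lev_out v i hv
    · simp at h
  inj := by
    rintro (⟨n, p⟩ | ⟨p, v⟩ | b) h i j hij
    · cases n <;> simpa [place] using hij
    · by_cases hv : G.lev v = 0
      · simpa [hv] using hij
      · simp [hv] at hij
        exact G.inj v hv hij
    · simp at h
  root := place G N n []

theorem step_force {d k t : ℕ} (hk : 2 ≤ k) (κ : Type) (G : LG d)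
    (hG : G.Force k t (Finset (Fin d))) (N n : ℕ) (leaf : List (Fin d) → (Fin d ↪ Fin N))
    (hleaf : ∀ w : Fin N → κ, Wins k n leaf (fun e => ∃ a, ∀ i, w (e i) = a)) :
    (stepLG G N n leaf).Force k (t + 1) κ := by
  classical
  intro P c col hr hP
  let cp : List (Fin d) → G.V → (stepLG G N n leaf).V := fun p v => Sum.inr (Sum.inl (p, v))
  let bt : Fin N → (stepLG G N n leaf).V := fun b => Sum.inr (Sum.inr b)
  have lev_cp : ∀ p v, (stepLG G N n leaf).lev (cp p v) = G.lev v + 1 := fun _ _ => rfl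
  have lev_bt : ∀ b, (stepLG G N n leaf).lev (bt b) = 0 := fun _ => rfl
  have out_cp : ∀ p v i, G.lev v ≠ 0 → (stepLG G N n leaf).out (cp p v) i = cp p (G.out v i) :=
    fun p v i h => if_neg h
  have out_cp0 : ∀ p v i, G.lev v = 0 → (stepLG G N n leaf).out (cp p v) i = bt (leaf p i) :=
    fun p v i h => if_pos h
  have cp_inj : ∀ p, Function.Injective (cp p) := by
    intro p v w h
    exact (Prod.mk.inj (Sum.inl.inj (Sum.inr.inj h))).2
  have bt_inj : Function.Injective bt := by
    intro v w h
    exact Sum.inr.inj (Sum.inr.inj h)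
  obtain ⟨p, hp, hpQ, a, ha⟩ := hleaf (fun b => col (bt b))
    (fun p => place G N (n - p.length) p ∈ P) hr (by
      intro p hp hpQ
      obtain ⟨j, hj⟩ : ∃ j, n - p.length = j + 1 := ⟨n - p.length - 1, by omega⟩
      rw [hj] at hpQ
      obtain ⟨h1, h2⟩ := hP _ hpQ (by simp [place, stepLG])
      refine ⟨_, h1, fun i hi => ?_⟩
      have h3 := h2 i hi
      have h4 : n - (i :: p).length = j := by simp; omega
      rw [h4]
      exact h3)
  simp only [hp, Nat.sub_self] at hpQ
  obtain ⟨S, hSP, hS, ⟨A, hA⟩, hb⟩ := hG {v | cp p v ∈ P} (fun v => c (cp p v))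
    (fun v => c (cp p v)) hpQ (by
      intro v hv hv0
      obtain ⟨h1, h2⟩ := hP _ hv (by rw [lev_cp]; omega)
      refine ⟨h1, fun i hi => ?_⟩
      have := h2 i hi
      rwa [out_cp _ _ _ hv0] at this)
  have hAk : k ≤ A.card ∧ ∀ i ∈ A, bt (leaf p i) ∈ P := by
    obtain ⟨s, hs, hsk⟩ := hb
    obtain ⟨v, hv⟩ := Finset.card_pos.1 (show 0 < s.card by omega)
    obtain ⟨hvS, hv0⟩ := hs hv
    obtain ⟨h1, h2⟩ := hP _ (hSP hvS) (by rw [lev_cp]; omega)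
    have hcA : c (cp p v) = A := hA v hvS hv0
    rw [hcA] at h1 h2
    refine ⟨h1, fun i hi => ?_⟩
    have := h2 i hi
    rwa [out_cp0 _ _ _ hv0] at this
  refine ⟨cp p '' S ∪ (fun i => bt (leaf p i)) '' (A : Set (Fin d)), ?_, ?_, ⟨a, ?_⟩, ?_⟩
  · rintro _ (⟨v, hv, rfl⟩ | ⟨i, hi, rfl⟩)
    · exact hSP hv
    · exact hAk.2 i hi
  · rintro _ (⟨v, hv, rfl⟩ | ⟨i, hi, rfl⟩)
    · obtain ⟨h1, h2, h3⟩ := hS v hv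
      rw [lev_cp]
      refine ⟨by omega, fun _ i hi => ?_, fun ht => ?_⟩
      · by_cases hv0 : G.lev v = 0
        · rw [out_cp0 _ _ _ hv0]
          have hcA : c (cp p v) = A := hA v hv hv0
          rw [hcA] at hi
          exact Or.inr ⟨i, hi, rfl⟩
        · rw [out_cp _ _ _ hv0]
          exact Or.inl ⟨_, h2 hv0 i hi, rfl⟩
      · obtain ⟨s, hs, hsk⟩ := h3 (by omega)
        refine ⟨s.image (cp p), ?_, by rwa [Finset.card_image_of_injective _ (cp_inj p)]⟩
        intro u hu
        simp only [Finset.coe_image, Set.mem_image, Finset.mem_coe] at hu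
        obtain ⟨u, hu, rfl⟩ := hu
        obtain ⟨k1, k2, i, hi, k3⟩ := hs hu
        refine ⟨Or.inl ⟨u, k1, rfl⟩, by rw [lev_cp]; omega, i, hi, ?_⟩
        rw [out_cp _ _ _ k2, k3]
    · simp only [lev_bt]
      refine ⟨by omega, fun h => absurd rfl h, fun _ => ?_⟩
      obtain ⟨s, hs, hsk⟩ := hb
      refine ⟨s.image (cp p), ?_, by rwa [Finset.card_image_of_injective _ (cp_inj p)]⟩
      intro u hu
      simp only [Finset.coe_image, Set.mem_image, Finset.mem_coe] at hu
      obtain ⟨u, hu, rfl⟩ := hu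
      obtain ⟨k1, k2⟩ := hs hu
      have hcA : c (cp p u) = A := hA u k1 k2
      refine ⟨Or.inl ⟨u, k1, rfl⟩, by rw [lev_cp]; omega, i, by rw [hcA]; exact hi, ?_⟩
      rw [out_cp0 _ _ _ k2]
  · rintro _ (⟨v, hv, rfl⟩ | ⟨i, hi, rfl⟩) h0
    · rw [lev_cp] at h0; omega
    · exact ha i
  · refine ⟨A.image (fun i => bt (leaf p i)), ?_, ?_⟩
    · intro u hu
      simp only [Finset.coe_image, Set.mem_image, Finset.mem_coe] at hu
      obtain ⟨i, hi, rfl⟩ := hu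
      exact ⟨Or.inr ⟨i, hi, rfl⟩, rfl⟩
    · rw [Finset.card_image_of_injective]
      · exact hAk.1
      · exact bt_inj.comp (leaf p).injective

theorem exists_force (k d t : ℕ) (hk : 2 ≤ k) (hd : 1 ≤ d) (ht : 1 ≤ t) :
    ∀ (κ : Type) [Fintype κ], ∃ G : LG d, G.Force k t κ := by
  classical
  induction t, ht using Nat.le_induction with
  | base => exact fun κ _ => ⟨_, treeLG_force d k hk κ _ rfl⟩
  | succ t ht ih =>
    intro κ _
    obtain ⟨G, hG⟩ := ih (Finset (Fin d))
    obtain ⟨N, hN⟩ := mono_set d κ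
    obtain ⟨n, leaf, hl⟩ := exists_wins (d := d) (k := k) hd hk
      (fun (w : Fin N → κ) (e : Fin d ↪ Fin N) => ∃ a, ∀ i, w (e i) = a) hN Finset.univ
    exact ⟨_, step_force hk κ G hG N n leaf fun w => hl w (Finset.mem_univ _)⟩

/-- reachability in the ranked graph -/
inductive LG.Reach {d : ℕ} (G : LG d) : G.V → Prop
  | root : G.Reach G.root
  | step (v : G.V) (i : Fin d) : G.Reach v → G.lev v ≠ 0 → G.Reach (G.out v i)

/-- The digraph of a ranked graph. -/
def LG.toD {d : ℕ} (G : LG d) : Digraph' G.V where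
  verts := {v | G.Reach v}
  Adj u v := G.Reach u ∧ G.lev u ≠ 0 ∧ ∃ i, G.out u i = v
  ne_of_adj := by
    rintro u v ⟨-, h, i, rfl⟩ he
    have := G.lev_out u i h
    rw [← he] at this
    omega
  mem_verts_left := fun u v h => h.1
  mem_verts_right := by
    rintro u v ⟨h1, h, i, rfl⟩
    exact LG.Reach.step u i h1 h

theorem LG.reach_le {d : ℕ} (G : LG d) {v : G.V} (h : G.Reach v) : G.lev v ≤ G.lev G.root := by
  induction h with
  | root => rfl
  | step v i h h0 ih => have := G.lev_out v i h0; omega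

theorem LG.walk_lev {d : ℕ} (G : LG d) (n : ℕ) (u v : G.V) (h : WalkOfLen G.toD u v n) :
    G.lev v + n = G.lev u := by
  induction n generalizing u with
  | zero => simp [h.1]
  | succ n ih =>
    obtain ⟨w, ⟨-, h0, i, rfl⟩, hw⟩ := h
    have := ih _ hw
    have := G.lev_out u i h0
    omega

theorem walk_snoc {α : Type} (D : Digraph' α) (n : ℕ) (u v w : α) (h : WalkOfLen D u v n)
    (hvw : D.Adj v w) : WalkOfLen D u w (n + 1) := by
  induction n generalizing u with
  | zero =>
    obtain ⟨rfl, -⟩ := h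
    exact ⟨w, hvw, rfl, D.mem_verts_right hvw⟩
  | succ n ih =>
    obtain ⟨x, hx, hw⟩ := h
    exact ⟨x, hx, ih _ hw⟩

theorem LG.exists_walk {d : ℕ} (G : LG d) {v : G.V} (h : G.Reach v) :
    ∃ n, WalkOfLen G.toD G.root v n := by
  induction h with
  | root => exact ⟨0, rfl, .root⟩
  | step v i h h0 ih =>
    obtain ⟨n, hn⟩ := ih
    exact ⟨n + 1, walk_snoc _ _ _ _ _ hn ⟨h, h0, i, rfl⟩⟩

theorem LG.mem_layer {d : ℕ} (G : LG d) {v : G.V} (h : G.Reach v) (j : ℕ) :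
    v ∈ layerSet G.toD G.root j ↔ G.lev v + j = G.lev G.root := by
  constructor
  · exact fun hv => G.walk_lev _ _ _ hv.1
  · intro hj
    obtain ⟨n, hn⟩ := G.exists_walk h
    have := G.walk_lev _ _ _ hn
    obtain rfl : n = j := by omega
    refine ⟨hn, fun i hi hw => ?_⟩
    have := G.walk_lev _ _ _ hw
    omega

/-- For all `k ≥ 2`, `d ≥ 1`, `t ≥ 1` there is a layered rooted digraph `D`
(with root `r` and bottom layer `layerSet D r m`) in which every vertex not in
the bottom layer has out-degree exactly `d`, such that: whenever `H ⊆ D`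
contains the root and every vertex of `H` not in the bottom layer of `D` has
out-degree at least `k` in `H`, then `H` has a nonempty induced subdigraph
contained in the bottom `t` layers of `D` in which every vertex has in- and
out-degree at least `k`, except that vertices in the first layer from the
bottom have out-degree zero and vertices in the `t`-th layer from the bottom
have in-degree zero. -/
theorem layered_digraph_lemma :
    ∀ k d t : ℕ, 2 ≤ k → 1 ≤ d → 1 ≤ t →
    ∃ (α : Type) (D : Digraph' α) (r : α) (m : ℕ),
      r ∈ D.verts ∧ (∀ v ∈ D.verts, ∃ n : ℕ, WalkOfLen D r v n) ∧
      (∀ ⦃u v : α⦄, D.Adj u v →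
        ∃ i : ℕ, u ∈ layerSet D r i ∧ v ∈ layerSet D r (i + 1)) ∧
      (∀ v ∈ D.verts, D.outNbrs v = ∅ → v ∈ layerSet D r m) ∧
      (∀ v ∈ D.verts, v ∉ layerSet D r m →
        (D.outNbrs v).Finite ∧ (D.outNbrs v).ncard = d) ∧
      ∀ H : Digraph' α, H.IsSubdigraph D → r ∈ H.verts →
        (∀ v ∈ H.verts, v ∉ layerSet D r m → AtLeast (H.outNbrs v) k) →
        ∃ S : Set α, S.Nonempty ∧ S ⊆ H.verts ∧
          ∀ v ∈ S, ∃ j : ℕ, j ≤ m ∧ m < j + t ∧ v ∈ layerSet D r j ∧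
            (j = m → {u | u ∈ S ∧ H.Adj v u} = ∅) ∧
            (j ≠ m → AtLeast {u | u ∈ S ∧ H.Adj v u} k) ∧
            (j + t = m + 1 → {u | u ∈ S ∧ H.Adj u v} = ∅) ∧
            (j + t ≠ m + 1 → AtLeast {u | u ∈ S ∧ H.Adj u v} k) := by
  classical
  intro k d t hk hd ht
  obtain ⟨G, hG⟩ := exists_force k d t hk hd ht Unit
  have hbot : ∀ v, G.Reach v → (v ∈ layerSet G.toD G.root (G.lev G.root) ↔ G.lev v = 0) := by
    intro v hv
    rw [G.mem_layer hv]; omega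
  refine ⟨G.V, G.toD, G.root, G.lev G.root, .root, fun v hv => G.exists_walk hv, ?_, ?_, ?_, ?_⟩
  · rintro u v ⟨hu, h0, i, rfl⟩
    have h1 := G.reach_le hu
    have h2 := G.lev_out u i h0
    refine ⟨G.lev G.root - G.lev u, (G.mem_layer hu _).2 (by omega),
      (G.mem_layer (.step u i hu h0) _).2 (by omega)⟩
  · intro v hv h
    rw [hbot v hv]
    by_contra h0
    have : G.out v ⟨0, hd⟩ ∈ G.toD.outNbrs v := ⟨hv, h0, _, rfl⟩
    rw [h] at this
    exact this
  · intro v hv h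
    rw [hbot v hv] at h
    have : G.toD.outNbrs v = Set.range (G.out v) := by
      ext u
      exact ⟨fun hu => hu.2.2, fun hu => ⟨hv, h, hu⟩⟩
    rw [this]
    refine ⟨Set.finite_range _, ?_⟩
    rw [← Set.image_univ, Set.ncard_image_of_injective _ (G.inj v h)]
    simp
  · intro H hH hr hdeg
    have hadj : ∀ ⦃u v⦄, H.Adj u v → G.Reach u ∧ G.lev u ≠ 0 ∧ ∃ i, G.out u i = v := hH.2
    have hreach : ∀ v ∈ H.verts, G.Reach v := hH.1
    let c : G.V → Finset (Fin d) := fun v => Finset.univ.filter fun i => H.Adj v (G.out v i)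
    have hcard : ∀ v ∈ H.verts, G.lev v ≠ 0 → k ≤ (c v).card := by
      intro v hv h0
      obtain ⟨s, hs, hsk⟩ := hdeg v hv (by rw [hbot v (hreach v hv)]; exact h0)
      have : s ⊆ (c v).image (G.out v) := by
        intro u hu
        have h1 : H.Adj v u := hs hu
        obtain ⟨-, -, i, rfl⟩ := hadj h1
        exact Finset.mem_image_of_mem _ (by simpa [c] using h1)
      exact hsk.trans ((Finset.card_le_card this).trans Finset.card_image_le)
    obtain ⟨S, hSP, hS, -, s, hs, hsk⟩ := hG H.verts c (fun _ => ()) hr (by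
      intro v hv h0
      refine ⟨hcard v hv h0, fun i hi => ?_⟩
      simp only [c, Finset.mem_filter] at hi
      exact H.mem_verts_right hi.2)
    obtain ⟨x, hx⟩ := Finset.card_pos.1 (show 0 < s.card by omega)
    refine ⟨S, ⟨x, (hs hx).1⟩, hSP, fun v hv => ?_⟩
    have hR := hreach v (hSP hv)
    have hle := G.reach_le hR
    obtain ⟨h1, h2, h3⟩ := hS v hv
    refine ⟨G.lev G.root - G.lev v, by omega, by omega, (G.mem_layer hR _).2 (by omega),
      ?_, ?_, ?_, ?_⟩
    · intro hj
      ext u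
      simp only [Set.mem_ofPred_eq, Set.mem_empty_iff_false, iff_false, not_and]
      intro _ ha
      have := (hadj ha).2.1
      omega
    · intro hj
      have h0 : G.lev v ≠ 0 := by omega
      refine ⟨(c v).image (G.out v), ?_, ?_⟩
      · intro u hu
        simp only [Finset.coe_image, Set.mem_image, Finset.mem_coe] at hu
        obtain ⟨i, hi, rfl⟩ := hu
        refine ⟨h2 h0 i hi, ?_⟩
        simpa [c] using hi
      · rw [Finset.card_image_of_injective _ (G.inj v h0)]
        exact hcard v (hSP hv) h0
    · intro hj
      ext u
      simp only [Set.mem_ofPred_eq, Set.mem_empty_iff_false, iff_false, not_and]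
      intro hu ha
      obtain ⟨-, h0, i, rfl⟩ := hadj ha
      have := G.lev_out u i h0
      have := (hS u hu).1
      omega
    · intro hj
      obtain ⟨s, hs, hsk⟩ := h3 (by omega)
      refine ⟨s, fun u hu => ?_, hsk⟩
      obtain ⟨k1, k2, i, hi, rfl⟩ := hs hu
      refine ⟨k1, ?_⟩
      simpa [c] using hi
end

section
/- Let k ≥ 100 and let D be a 3-partite digraph with minimum out-degree at least k^20 that is 1-typed with witnessing partition (A,B,C), and suppose D contains no directed triangle C_3^{(1)}. Then D contains a spanning subdigraph D' in which every vertex has out-degree exactly k and such that D' contains no copy of C_5^{(2)} whose source lies in N_1⁻(A), the set of vertices of D having an out-neighbor in A. -/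
open Digraph'

/-- `(A, B, C)` is a tripartition of `D`: it partitions the vertex set and no
arc has both endpoints in the same part. -/
def IsTripartition {α : Type} (D : Digraph' α) (A B C : Set α) : Prop :=
  A ∪ B ∪ C = D.verts ∧ Disjoint A B ∧ Disjoint A C ∧ Disjoint B C ∧
    ∀ ⦃u v : α⦄, D.Adj u v →
      ¬(u ∈ A ∧ v ∈ A) ∧ ¬(u ∈ B ∧ v ∈ B) ∧ ¬(u ∈ C ∧ v ∈ C)

/-- The set of vertices reachable from `S` by a directed walk of length
exactly `n`. -/
def nthOutSet {α : Type} (D : Digraph' α) (S : Set α) : ℕ → Set α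
  | 0 => S
  | n + 1 => {v | ∃ u ∈ nthOutSet D S n, D.Adj u v}

/-- `D` is `s`-typed with witnessing partition `(A, B, C)`: every vertex `v`
has a word `t ∈ {A,B,C}^s` with `N_i⁺(v) ⊆ t i` for all `1 ≤ i ≤ s`. -/
def TypedWith {α : Type} (D : Digraph' α) (A B C : Set α) (s : ℕ) : Prop :=
  ∀ v ∈ D.verts, ∃ t : Fin s → Set α,
    (∀ i : Fin s, t i = A ∨ t i = B ∨ t i = C) ∧
    ∀ i : Fin s, nthOutSet D {v} (i.val + 1) ⊆ t i

/-- A loopless finite digraph with out-degrees at most `d` on at least `s (2 d + 1)` vertices has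
an independent set of size `s`. -/
theorem exists_indep_aux {α : Type} (h : α → α → Prop) (d : ℕ) :
    ∀ (s : ℕ) (V : Finset α), (∀ a ∈ V, ¬ h a a) →
      (∀ a ∈ V, ∃ F : Finset α, F.card ≤ d ∧ ∀ b ∈ V, h a b → b ∈ F) →
      s * (2 * d + 1) ≤ V.card →
      ∃ I ⊆ V, I.card = s ∧ ∀ a ∈ I, ∀ b ∈ I, ¬ h a b := by
  classical
  intro s
  induction s with
  | zero => intro V _ _ _; exact ⟨∅, by simp, by simp, by simp⟩
  | succ s ih =>
    intro V hl hd hc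
    have hout : ∀ a ∈ V, (V.bipartiteAbove h a).card ≤ d := by
      intro a ha
      obtain ⟨F, hF, hF2⟩ := hd a ha
      refine (Finset.card_le_card ?_).trans hF
      intro b hb
      rw [Finset.mem_bipartiteAbove] at hb
      exact hF2 b hb.1 hb.2
    have hne : V.Nonempty := by
      rw [← Finset.card_pos]
      nlinarith
    have hin : ∃ x ∈ V, (V.bipartiteBelow h x).card ≤ d := by
      by_contra! hcon
      have h1 : ∑ b ∈ V, (V.bipartiteBelow h b).card ≤ ∑ b ∈ V, d := by
        rw [← Finset.sum_card_bipartiteAbove_eq_sum_card_bipartiteBelow]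
        exact Finset.sum_le_sum hout
      have h2 : ∑ b ∈ V, d < ∑ b ∈ V, (V.bipartiteBelow h b).card :=
        Finset.sum_lt_sum_of_nonempty hne hcon
      omega
    obtain ⟨x, hx, hxin⟩ := hin
    set Z := insert x (V.bipartiteAbove h x ∪ V.bipartiteBelow h x) with hZ
    have hZc : Z.card ≤ 2 * d + 1 := by
      have h1 := Finset.card_insert_le x (V.bipartiteAbove h x ∪ V.bipartiteBelow h x)
      have h2 := Finset.card_union_le (V.bipartiteAbove h x) (V.bipartiteBelow h x)
      have h3 := hout x hx
      rw [hZ]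
      omega
    have hVZ : s * (2 * d + 1) ≤ (V \ Z).card := by
      have h1 := Finset.le_card_sdiff Z V
      have h2 : (s + 1) * (2 * d + 1) = s * (2 * d + 1) + (2 * d + 1) := by ring
      omega
    have hsub : V \ Z ⊆ V := Finset.sdiff_subset
    obtain ⟨I, hI, hIc, hInd⟩ := ih (V \ Z) (fun a ha => hl a (hsub ha))
      (fun a ha => by
        obtain ⟨F, hF, hF2⟩ := hd a (hsub ha)
        exact ⟨F, hF, fun b hb => hF2 b (hsub hb)⟩) hVZ
    have key : ∀ a ∈ I, a ∈ V ∧ a ≠ x ∧ ¬ h x a ∧ ¬ h a x := by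
      intro a ha
      have h1 := hI ha
      simp only [hZ, Finset.mem_sdiff, Finset.mem_insert, Finset.mem_union,
        Finset.mem_bipartiteAbove, Finset.mem_bipartiteBelow] at h1
      tauto
    refine ⟨insert x I, ?_, ?_, ?_⟩
    · intro a ha
      rcases Finset.mem_insert.1 ha with rfl | ha
      · exact hx
      · exact (key a ha).1
    · rw [Finset.card_insert_of_notMem, hIc]
      intro hxI
      exact (key x hxI).2.1 rfl
    · intro a ha b hb
      rcases Finset.mem_insert.1 ha with rfl | ha2 <;>
        rcases Finset.mem_insert.1 hb with hbx | hb2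
      · rw [hbx]; exact hl _ hx
      · exact (key b hb2).2.2.1
      · rw [hbx]; exact (key a ha2).2.2.2
      · exact hInd a ha2 b hb2

/-- One pass of greedy thinning, with respect to a bounded ranking `e`. -/
theorem one_pass_aux {ι α : Type} (N : ι → Finset α) (R : α → Finset ι) (m s : ℕ)
    (hR : ∀ a, (R a).card ≤ m) (hN : ∀ v, s * (2 * (m * s) + 1) ≤ (N v).card)
    (hNR : ∀ a w, a ∈ N w → w ∉ R a) (e : ι → ℕ) (M : ℕ) (he : ∀ v, e v < M) :
    ∃ S : ι → Finset α, (∀ v, S v ⊆ N v ∧ (S v).card = s) ∧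
      ∀ v w, e w < e v → ∀ a ∈ S v, ∀ b ∈ S v, w ∈ R a → b ∉ S w := by
  classical
  suffices hP : ∀ n : ℕ, ∃ S : ι → Finset α, (∀ v, S v ⊆ N v ∧ (S v).card = s) ∧
      ∀ v w, e v < n → e w < e v → ∀ a ∈ S v, ∀ b ∈ S v, w ∈ R a → b ∉ S w by
    obtain ⟨S, h1, h2⟩ := hP M
    exact ⟨S, h1, fun v w => h2 v w (he v)⟩
  intro n
  induction n with
  | zero =>
    have h0 : ∀ v, ∃ t ⊆ N v, t.card = s := fun v =>
      Finset.exists_subset_card_eq (by nlinarith [hN v, Nat.zero_le (s * (m * s))])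
    choose S hS using h0
    exact ⟨S, hS, by intro v w hv; omega⟩
  | succ n ih =>
    obtain ⟨S, hS, hgood⟩ := ih
    have hpick : ∀ v, ∃ I ⊆ N v, I.card = s ∧
        ∀ a ∈ I, ∀ b ∈ I, ¬ (∃ w ∈ R a, b ∈ S w) := by
      intro v
      refine exists_indep_aux (fun a b => ∃ w ∈ R a, b ∈ S w) (m * s) s (N v) ?_ ?_ (hN v)
      · rintro a - ⟨w, hw, haw⟩
        exact hNR a w ((hS w).1 haw) hw
      · intro a _
        refine ⟨(R a).biUnion S, ?_, ?_⟩
        · exact (Finset.card_biUnion_le_card_mul _ _ s (fun w _ => (hS w).2.le)).trans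
            (Nat.mul_le_mul_right _ (hR a))
        · rintro b - ⟨w, hw, hb⟩
          exact Finset.mem_biUnion.2 ⟨w, hw, hb⟩
    choose P hP1 hP2 hP3 using hpick
    refine ⟨fun v => if e v = n then P v else S v, ?_, ?_⟩
    · intro v
      by_cases hv : e v = n
      · simp only [hv, if_true]; exact ⟨hP1 v, hP2 v⟩
      · simp only [hv, if_false]; exact hS v
    · intro v w hv hwv a ha b hb hw hbw
      have hwn : e w ≠ n := by omega
      simp only [hwn, if_false] at hbw
      by_cases hvn : e v = n
      · simp only [hvn, if_true] at ha hb
        exact hP3 v a ha b hb ⟨w, hw, hbw⟩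
      · simp only [hvn, if_false] at ha hb
        exact hgood v w (by omega) hwv a ha b hb hw hbw

/-- The core selection lemma: thin the lists `N v` to `k`-sets `S v` such that `S v` is disjoint
from `S w` whenever `w ∈ R a` for some `a ∈ S v`. -/
theorem core_selection_aux {ι α : Type} (k : ℕ) (hk : 100 ≤ k) (N : ι → Finset α)
    (R : α → Finset ι) (hR : ∀ a, (R a).card ≤ k * k) (hN : ∀ v, (N v).card = k ^ 20)
    (hNR : ∀ a w, a ∈ N w → w ∉ R a) :
    ∃ S : ι → Finset α, (∀ v, S v ⊆ N v ∧ (S v).card = k) ∧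
      ∀ v w, ∀ a ∈ S v, ∀ b ∈ S v, w ∈ R a → b ∉ S w := by
  classical
  have num1 : k ^ 8 * (2 * (k * k * k ^ 8) + 1) ≤ k ^ 20 := by
    have h1 : 1 ≤ k ^ 10 := Nat.one_le_pow _ _ (by omega)
    have h2 : 3 ≤ k ^ 2 := by nlinarith
    calc k ^ 8 * (2 * (k * k * k ^ 8) + 1) = k ^ 8 * (2 * k ^ 10 + 1) := by ring
      _ ≤ k ^ 8 * (3 * k ^ 10) := Nat.mul_le_mul_left _ (by omega)
      _ ≤ k ^ 8 * (k ^ 2 * k ^ 10) :=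
          Nat.mul_le_mul_left _ (Nat.mul_le_mul_right _ h2)
      _ = k ^ 20 := by ring
  have num2 : k * (2 * (k * k * k) + 1) ≤ k ^ 8 := by
    have h1 : 1 ≤ k ^ 3 := Nat.one_le_pow _ _ (by omega)
    have h2 : 3 ≤ k ^ 4 := (by omega : 3 ≤ k).trans (Nat.le_self_pow (by norm_num) k)
    calc k * (2 * (k * k * k) + 1) = k * (2 * k ^ 3 + 1) := by ring
      _ ≤ k * (3 * k ^ 3) := Nat.mul_le_mul_left _ (by omega)
      _ ≤ k * (k ^ 4 * k ^ 3) :=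
          Nat.mul_le_mul_left _ (Nat.mul_le_mul_right _ h2)
      _ = k ^ 8 := by ring
  -- the finite version
  have hfin : ∀ s : Finset ι, ∃ S : ι → Finset α, (∀ v, S v ⊆ N v ∧ (S v).card = k) ∧
      ∀ v ∈ s, ∀ w ∈ s, ∀ a ∈ S v, ∀ b ∈ S v, w ∈ R a → b ∉ S w := by
    intro s
    let e : ι → ℕ := fun v => if h : v ∈ s then (s.equivFin ⟨v, h⟩ : ℕ) else 0
    have he : ∀ v, e v < s.card + 1 := by
      intro v
      by_cases h : v ∈ s
      · simp only [e, h, dif_pos]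
        have := (s.equivFin ⟨v, h⟩).2
        omega
      · simp [e, h]
    have hinj : ∀ v ∈ s, ∀ w ∈ s, e v = e w → v = w := by
      intro v hv w hw hvw
      simp only [e, hv, hw, dif_pos] at hvw
      have h1 := s.equivFin.injective (Fin.ext hvw)
      exact congrArg Subtype.val h1
    obtain ⟨S1, h11, h12⟩ := one_pass_aux N R (k * k) (k ^ 8) hR
      (fun v => by rw [hN]; exact num1) hNR e (s.card + 1) he
    obtain ⟨S2, h21, h22⟩ := one_pass_aux S1 R (k * k) k hR
      (fun v => by rw [(h11 v).2]; exact num2)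
      (fun a w ha => hNR a w ((h11 w).1 ha)) (fun v => s.card + 1 - e v) (s.card + 2)
      (fun v => by omega)
    refine ⟨S2, fun v => ⟨(h21 v).1.trans (h11 v).1, (h21 v).2⟩, ?_⟩
    intro v hv w hw a ha b hb hwa hbw
    rcases lt_trichotomy (e w) (e v) with hlt | heq | hgt
    · exact h12 v w hlt a ((h21 v).1 ha) b ((h21 v).1 hb) hwa ((h21 w).1 hbw)
    · have := hinj w hw v hv heq
      subst this
      exact hNR a w ((h11 w).1 ((h21 w).1 ha)) hwa
    · refine h22 v w ?_ a ha b hb hwa hbw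
      have := he w
      show s.card + 1 - e w < s.card + 1 - e v
      omega
  choose G hG1 hG2 using hfin
  obtain ⟨χ, hχ⟩ := Finset.rado_selection (β := fun v : ι => {x // x ∈ (N v).powerset})
    (fun s v => ⟨G s v, Finset.mem_powerset.2 (hG1 s v).1⟩)
  refine ⟨fun v => (χ v).1, ?_, ?_⟩
  · intro v
    obtain ⟨t, _, ht⟩ := hχ {v}
    have := ht v (by simp)
    simp only [this]
    exact hG1 t v
  · intro v w a ha b hb hwa hbw
    obtain ⟨t, hst, ht⟩ := hχ {v, w}
    have h1 := ht v (by simp)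
    have h2 := ht w (by simp)
    simp only [h1] at ha hb
    simp only [h2] at hbw
    exact hG2 t v (hst (by simp)) w (hst (by simp)) a ha b hb hwa hbw

/-- Let `k ≥ 100` and let `D` be a 3-partite digraph of minimum out-degree at
least `k^20` which is 1-typed with witness `(A,B,C)` and contains no directed
triangle `C₃⁽¹⁾`.  Then `D` has a spanning subdigraph `D'` in which every
vertex has out-degree exactly `k` and which contains no copy of `C₅⁽²⁾` whose
source has an out-neighbour in `A` (in `D`). -/
theorem C5_two_source_removal :
    ∀ (k : ℕ) (α : Type) (D : Digraph' α) (A B C : Set α), 100 ≤ k →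
      IsTripartition D A B C →
      (∀ v ∈ D.verts, D.outNbrs v ⊆ A ∨ D.outNbrs v ⊆ B ∨ D.outNbrs v ⊆ C) →
      D.MinOutDegAtLeast (k ^ 20) →
      (¬ ∃ f : Fin 3 → α, Function.Injective f ∧
        D.Adj (f 0) (f 1) ∧ D.Adj (f 1) (f 2) ∧ D.Adj (f 2) (f 0)) →
      ∃ D' : Digraph' α, D'.IsSubdigraph D ∧ D'.verts = D.verts ∧
        (∀ v ∈ D'.verts, (D'.outNbrs v).Finite ∧ (D'.outNbrs v).ncard = k) ∧
        ¬ ∃ f : Fin 5 → α, Function.Injective f ∧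
          D'.Adj (f 0) (f 1) ∧ D'.Adj (f 1) (f 2) ∧ D'.Adj (f 2) (f 3) ∧
          D'.Adj (f 3) (f 4) ∧ D'.Adj (f 0) (f 4) ∧
          ∃ a ∈ A, D.Adj (f 0) a := by
  classical
  intro k α D A B C hk hpart htyped hdeg htri
  obtain ⟨hU, hAB, hAC, hBC, hind⟩ := hpart
  -- full lists
  have hex : ∀ v : {v // v ∈ D.verts}, ∃ t : Finset α, ↑t ⊆ D.outNbrs v.1 ∧ t.card = k ^ 20 := by
    intro v
    obtain ⟨t, ht, hc⟩ := hdeg v.1 v.2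
    obtain ⟨t2, ht2, hc2⟩ := Finset.exists_subset_card_eq hc
    exact ⟨t2, fun x hx => ht (ht2 hx), hc2⟩
  choose N hN1 hN2 using hex
  have hex2 : ∀ v : α, ∃ g : Finset α, (∀ x ∈ g, D.Adj v x) ∧ g.card ≤ k ∧
      (v ∈ D.verts → g.card = k) := by
    intro v
    by_cases hv : v ∈ D.verts
    · obtain ⟨g, hg, hc⟩ := Finset.exists_subset_card_eq
        (s := N ⟨v, hv⟩) (n := k) (by rw [hN2]; exact Nat.le_self_pow (by norm_num) k)
      exact ⟨g, fun x hx => hN1 ⟨v, hv⟩ (hg hx), hc.le, fun _ => hc⟩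
    · exact ⟨∅, by simp, by simp, fun h => absurd h hv⟩
  choose g hg1 hg2 hg3 using hex2
  let R : α → Finset {v // v ∈ D.verts} := fun a =>
    ((g a).biUnion g).subtype (fun v => v ∈ D.verts)
  have hRmem : ∀ a w, w ∈ R a ↔ ∃ b ∈ g a, w.1 ∈ g b := by
    intro a w
    simp [R]
  obtain ⟨S, hS1, hS2⟩ := core_selection_aux k hk N R
    (by
      intro a
      refine (?_ : _ ≤ ((g a).biUnion g).card).trans ?_
      · simp only [R, Finset.card_subtype]
        exact Finset.card_filter_le _ _
      · exact (Finset.card_biUnion_le_card_mul _ _ k (fun w _ => hg2 w)).trans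
          (Nat.mul_le_mul_right _ (hg2 a)))
    hN2
    (by
      intro a w ha hw
      obtain ⟨b, hb, hwb⟩ := (hRmem a w).1 hw
      have h1 : D.Adj a b := hg1 a b hb
      have h2 : D.Adj b w.1 := hg1 b w.1 hwb
      have h3 : D.Adj w.1 a := hN1 w ha
      have n1 := D.ne_of_adj h1
      have n2 := D.ne_of_adj h2
      have n3 := D.ne_of_adj h3
      refine htri ⟨![a, b, w.1], ?_, h1, h2, h3⟩
      intro i j hij
      fin_cases i <;> fin_cases j <;> simp_all [eq_comm])
  have hSadj : ∀ (v : {v // v ∈ D.verts}) x, x ∈ S v → D.Adj v.1 x :=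
    fun v x hx => hN1 v ((hS1 v).1 hx)
  -- the final out-neighbourhoods
  let F : α → Finset α := fun v =>
    if h : v ∈ D.verts ∧ ∃ a ∈ A, D.Adj v a then S ⟨v, h.1⟩ else g v
  have hFadj : ∀ v x, x ∈ F v → D.Adj v x := by
    intro v x hx
    by_cases h : v ∈ D.verts ∧ ∃ a ∈ A, D.Adj v a
    · simp only [F, dif_pos h] at hx
      exact hSadj _ x hx
    · simp only [F, dif_neg h] at hx
      exact hg1 v x hx
  have hFcard : ∀ v ∈ D.verts, (F v).card = k := by
    intro v hv
    by_cases h : v ∈ D.verts ∧ ∃ a ∈ A, D.Adj v a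
    · simp only [F, dif_pos h]
      exact (hS1 _).2
    · simp only [F, dif_neg h]
      exact hg3 v hv
  refine ⟨⟨D.verts, fun u v => v ∈ F u, fun u v h => D.ne_of_adj (hFadj u v h),
    fun u v h => D.mem_verts_left (hFadj u v h),
    fun u v h => D.mem_verts_right (hFadj u v h)⟩, ⟨subset_rfl, fun u v h => hFadj u v h⟩,
    rfl, ?_, ?_⟩
  · intro v hv
    have : ({u | u ∈ F v} : Set α) = ↑(F v) := rfl
    simp only [outNbrs]
    rw [this]
    exact ⟨Finset.finite_toSet _, by rw [Set.ncard_coe_finset]; exact hFcard v hv⟩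
  · rintro ⟨f, -, h01, h12, h23, h34, h04, a, haA, h0a⟩
    simp only at h01 h12 h23 h34 h04
    have h0v : f 0 ∈ D.verts := D.mem_verts_left h0a
    have hsub : D.outNbrs (f 0) ⊆ A := by
      rcases htyped _ h0v with h | h | h
      · exact h
      · exact absurd (h h0a) (Set.disjoint_left.1 hAB haA)
      · exact absurd (h h0a) (Set.disjoint_left.1 hAC haA)
    have f1A : f 1 ∈ A := hsub (hFadj _ _ h01)
    have f4A : f 4 ∈ A := hsub (hFadj _ _ h04)
    have h34D := hFadj _ _ h34
    have f3v : f 3 ∈ D.verts := D.mem_verts_left h34D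
    have f3A : f 3 ∉ A := fun h => (hind h34D).1 ⟨h, f4A⟩
    have c0 : f 0 ∈ D.verts ∧ ∃ a ∈ A, D.Adj (f 0) a := ⟨h0v, a, haA, h0a⟩
    have c3 : f 3 ∈ D.verts ∧ ∃ a ∈ A, D.Adj (f 3) a := ⟨f3v, f 4, f4A, h34D⟩
    have c1 : ¬ (f 1 ∈ D.verts ∧ ∃ a ∈ A, D.Adj (f 1) a) := by
      rintro ⟨-, x, hx, hadj⟩
      exact (hind hadj).1 ⟨f1A, hx⟩
    have c2 : ¬ (f 2 ∈ D.verts ∧ ∃ a ∈ A, D.Adj (f 2) a) := by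
      rintro ⟨h2v, x, hx, hadj⟩
      have h23D := hFadj _ _ h23
      rcases htyped _ h2v with h | h | h
      · exact f3A (h h23D)
      · exact Set.disjoint_left.1 hAB hx (h hadj)
      · exact Set.disjoint_left.1 hAC hx (h hadj)
    simp only [F, dif_pos c0] at h01 h04
    simp only [F, dif_neg c1] at h12
    simp only [F, dif_neg c2] at h23
    simp only [F, dif_pos c3] at h34
    exact hS2 ⟨f 0, h0v⟩ ⟨f 3, f3v⟩ (f 1) h01 (f 4) h04
      ((hRmem _ _).2 ⟨f 2, h12, h23⟩) h34
end

section
/- Let t be a positive integer, let k be sufficiently large as a function of t, and let D be a k^{2t}-regular digraph. Then there exists a subdigraph D' of D with minimum out-degree at least k and a partition (V_1,…,V_t) of V(D') such that every arc of D' goes from V_i to V_{i+1} for some 1 ≤ i ≤ t (indices cyclic, with V_{t+1} = V_1), and every vertex of V(D') \ V_1 has in-degree at most 1 in D'. -/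
open Digraph'

/-- `D` is a `d`-regular digraph: every vertex has in- and out-degree `d`. -/
def IsRegularDigraph {α : Type} (D : Digraph' α) (d : ℕ) : Prop :=
  ∀ v ∈ D.verts, ((D.outNbrs v).Finite ∧ (D.outNbrs v).ncard = d) ∧
    ((D.inNbrs v).Finite ∧ (D.inNbrs v).ncard = d)

section Helpers
open Finset MeasureTheory ProbabilityTheory

theorem hall_lemma {α : Type} [DecidableEq α] (U : Set α) (N : α → Finset α) (k b : ℕ) (hb : 0 < b)
    (hout : ∀ u ∈ U, k * b ≤ #(N u))
    (hin : ∀ (v : α) (S : Finset α), (↑S ⊆ U) → #(S.filter (fun u => v ∈ N u)) ≤ b) :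
    ∃ F : U → Fin k → α, (∀ (u : U) (a : Fin k), F u a ∈ N (u : α)) ∧
      ∀ u a u' a', F u a = F u' a' → u = u' ∧ a = a' := by
  have key := (Finset.all_card_le_biUnion_card_iff_exists_injective
    (fun x : U × Fin k => N x.1)).1 ?_
  · obtain ⟨f, hf, hf'⟩ := key
    refine ⟨fun u a => f (u, a), fun u a => hf' (u, a), ?_⟩
    intro u a u' a' h
    have := hf h
    simpa using this
  · intro s
    set S : Finset α := s.image (fun x => (x.1 : α)) with hS
    have hSU : (S : Set α) ⊆ U := by
      intro x hx
      simp only [hS, coe_image, Set.mem_image] at hx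
      obtain ⟨y, _, rfl⟩ := hx
      exact y.1.2
    have h1 : #s ≤ #S * k := by
      have : #s ≤ #(S ×ˢ (univ : Finset (Fin k))) := by
        apply Finset.card_le_card_of_injOn (fun x => ((x.1 : α), x.2))
        · intro x hx
          simp only [coe_product, coe_univ, Set.mem_prod, Set.mem_univ, and_true, hS]
          exact mem_coe.2 (mem_image_of_mem _ hx)
        · rintro ⟨x, a⟩ _ ⟨y, c⟩ _ h
          simp only [Prod.mk.injEq] at h
          exact Prod.ext (Subtype.ext h.1) h.2
      simpa [card_product] using this
    have h2 : #S * (k * b) ≤ #(s.biUnion (fun x : U × Fin k => N x.1)) * b := by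
      apply Finset.card_mul_le_card_mul (fun u v => v ∈ N u)
      · intro u hu
        refine (hout u (hSU hu)).trans (card_le_card ?_)
        intro v hv
        rw [Finset.mem_bipartiteAbove]
        refine ⟨?_, hv⟩
        obtain ⟨y, hy, rfl⟩ := mem_image.1 hu
        exact mem_biUnion.2 ⟨y, hy, hv⟩
      · intro v _
        exact hin v S hSU
    have h3 : (#S * k) * b ≤ #(s.biUnion (fun x : U × Fin k => N x.1)) * b := by
      rw [mul_assoc]; exact h2
    exact h1.trans (Nat.le_of_mul_le_mul_right h3 hb)


theorem dep_eq {V ι : Type} (S : Finset V) (A : Set (V → ι))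
    (hA : ∀ f g : V → ι, (∀ x ∈ S, f x = g x) → f ∈ A → g ∈ A) :
    A = S.restrict ⁻¹' (S.restrict '' A) := by
  refine Set.Subset.antisymm (Set.subset_preimage_image _ _) ?_
  rintro g ⟨f, hf, h⟩
  refine hA f g (fun x hx => ?_) hf
  exact congrFun h ⟨x, hx⟩

theorem dep_measurable {V : Type} {M : ℕ} (S : Finset V) (A : Set (V → Fin M))
    (hA : ∀ f g : V → Fin M, (∀ x ∈ S, f x = g x) → f ∈ A → g ∈ A) : MeasurableSet A := by
  rw [dep_eq S A hA]
  exact (Finset.measurable_restrict S) (Set.toFinite _).measurableSet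

theorem dep_clopen {V : Type} {M : ℕ} (S : Finset V) (A : Set (V → Fin M))
    (hA : ∀ f g : V → Fin M, (∀ x ∈ S, f x = g x) → f ∈ A → g ∈ A) : IsClopen A := by
  rw [dep_eq S A hA]
  exact (isClopen_discrete _).preimage (by unfold Finset.restrict; fun_prop)

theorem dep_indep {V : Type} {M : ℕ} (ν : Measure (Fin M)) [IsProbabilityMeasure ν]
    (S T : Finset V) (hST : Disjoint S T) (A B : Set (V → Fin M))
    (hA : ∀ f g : V → Fin M, (∀ x ∈ S, f x = g x) → f ∈ A → g ∈ A)
    (hB : ∀ f g : V → Fin M, (∀ x ∈ T, f x = g x) → f ∈ B → g ∈ B) :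
    (Measure.infinitePi (fun _ : V => ν)).real (A ∩ B) =
      (Measure.infinitePi (fun _ : V => ν)).real A * (Measure.infinitePi (fun _ : V => ν)).real B := by
  have h := iIndepFun_infinitePi (P := fun _ : V => ν) (X := fun (_ : V) (x : Fin M) => x)
    (fun _ => measurable_id)
  have h2 := h.indepFun_finset S T hST (fun i => measurable_pi_apply i)
  have h3 := h2.measure_inter_preimage_eq_mul (S.restrict '' A) (T.restrict '' B)
    (Set.toFinite _).measurableSet (Set.toFinite _).measurableSet
  have eA : (fun (a : V → Fin M) (i : S) => a i) ⁻¹' (S.restrict '' A) = A := (dep_eq S A hA).symm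
  have eB : (fun (a : V → Fin M) (i : T) => a i) ⁻¹' (T.restrict '' B) = B := (dep_eq T B hB).symm
  rw [eA, eB] at h3
  simp only [measureReal_def, h3, ENNReal.toReal_mul]

section
variable {V J : Type} {M : ℕ}

def goodSet (E : J → Finset V) (B : J → Set (V → Fin M)) (S : Finset V) : Set (V → Fin M) :=
  {f | ∀ j, E j ⊆ S → f ∉ B j}

theorem goodSet_dep (E : J → Finset V) (B : J → Set (V → Fin M))
    (hB : ∀ j, ∀ f g : V → Fin M, (∀ x ∈ E j, f x = g x) → f ∈ B j → g ∈ B j)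
    (S : Finset V) :
    ∀ f g : V → Fin M, (∀ x ∈ S, f x = g x) → f ∈ goodSet E B S → g ∈ goodSet E B S := by
  intro f g h hf j hj hg
  exact hf j hj (hB j g f (fun x hx => (h x (hj hx)).symm) hg)

theorem lll_step [DecidableEq V] (ν : Measure (Fin M)) [IsProbabilityMeasure ν]
    (E : J → Finset V) (B : J → Set (V → Fin M))
    (hB : ∀ j, ∀ f g : V → Fin M, (∀ x ∈ E j, f x = g x) → f ∈ B j → g ∈ B j)
    (inc : V → Finset J) (hinc : ∀ v j, v ∈ E j → j ∈ inc v)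
    (d m : ℕ) (hd : ∀ j, #(E j) ≤ d) (hm : ∀ v, #(inc v) ≤ m)
    (q β : ℝ) (hβ : 0 < β) (hβ1 : β ≤ 1) (hq0 : 0 ≤ q)
    (hq : ∀ j, (Measure.infinitePi (fun _ : V => ν)).real (B j) ≤ q)
    (hmq : m * q ≤ (1 - β) * β ^ d) (n : ℕ) :
    ∀ (S : Finset V) (v : V), #S = n → v ∉ S →
      β * (Measure.infinitePi (fun _ : V => ν)).real (goodSet E B S) ≤
        (Measure.infinitePi (fun _ : V => ν)).real (goodSet E B (insert v S)) := by
  set μ := Measure.infinitePi (fun _ : V => ν) with hμ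
  induction n using Nat.strong_induction_on with
  | _ n ih =>
    intro S v hS hv
    have chain : ∀ (R T : Finset V), Disjoint R T → R ∪ T ⊆ S →
        β ^ #R * μ.real (goodSet E B T) ≤ μ.real (goodSet E B (R ∪ T)) := by
      intro R
      induction R using Finset.induction_on with
      | empty => intro T _ _; simp
      | insert x R hx ihR =>
        intro T hd hsub
        rw [Finset.disjoint_insert_left] at hd
        have hsub' : R ∪ T ⊆ S := by
          intro y hy; apply hsub; rw [insert_union]; exact mem_insert_of_mem hy
        have h1 := ihR T hd.2 hsub'
        have hxn : x ∉ R ∪ T := by simp [hx, hd.1]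
        have hlt : #(R ∪ T) < n := by
          rw [← hS]
          apply card_lt_card
          refine ⟨hsub', fun h => hxn (h (hsub ?_))⟩
          simp
        have h2 := ih _ hlt (R ∪ T) x rfl hxn
        rw [insert_union, card_insert_of_notMem hx, pow_succ]
        calc β ^ #R * β * μ.real (goodSet E B T)
            = β * (β ^ #R * μ.real (goodSet E B T)) := by ring
          _ ≤ β * μ.real (goodSet E B (R ∪ T)) := by gcongr
          _ ≤ _ := h2
    have hsubset : goodSet E B S ⊆ goodSet E B (insert v S) ∪
        ⋃ j ∈ inc v, (B j ∩ goodSet E B (S \ E j)) := by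
      intro f hf
      by_cases h : f ∈ goodSet E B (insert v S)
      · exact Or.inl h
      · right
        simp only [goodSet, Set.mem_ofPred_eq, not_forall, not_not] at h
        obtain ⟨j, hj, hfj⟩ := h
        have hvj : v ∈ E j := by
          by_contra hvj
          exact hf j ((Finset.subset_insert_iff_of_notMem hvj).1 hj) hfj
        simp only [Set.mem_iUnion]
        exact ⟨j, hinc v j hvj, hfj, fun i hi => hf i (hi.trans sdiff_subset)⟩
    have hterm : ∀ j ∈ inc v, μ.real (B j ∩ goodSet E B (S \ E j)) ≤
        q * ((β ^ d)⁻¹ * μ.real (goodSet E B S)) := by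
      intro j _
      rw [dep_indep ν (E j) (S \ E j) disjoint_sdiff _ _ (hB j) (goodSet_dep E B hB _)]
      have h1 := chain (S ∩ E j) (S \ E j)
        (disjoint_sdiff.mono_left inter_subset_right) (by
          rw [union_comm, sdiff_union_inter])
      rw [union_comm, sdiff_union_inter] at h1
      have h2 : β ^ d ≤ β ^ #(S ∩ E j) :=
        pow_le_pow_of_le_one hβ.le hβ1 ((card_le_card inter_subset_right).trans (hd j))
      have h3 : μ.real (goodSet E B (S \ E j)) ≤ (β ^ d)⁻¹ * μ.real (goodSet E B S) := by
        rw [le_inv_mul_iff₀ (pow_pos hβ d)]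
        exact (mul_le_mul_of_nonneg_right h2 measureReal_nonneg).trans h1
      exact mul_le_mul (hq j) h3 measureReal_nonneg hq0
    have hsum : μ.real (⋃ j ∈ inc v, (B j ∩ goodSet E B (S \ E j))) ≤
        (1 - β) * μ.real (goodSet E B S) := by
      calc _ ≤ ∑ j ∈ inc v, μ.real (B j ∩ goodSet E B (S \ E j)) :=
            measureReal_biUnion_finset_le _ _
        _ ≤ ∑ j ∈ inc v, q * ((β ^ d)⁻¹ * μ.real (goodSet E B S)) := sum_le_sum hterm
        _ = #(inc v) * (q * ((β ^ d)⁻¹ * μ.real (goodSet E B S))) := by simp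
        _ ≤ m * (q * ((β ^ d)⁻¹ * μ.real (goodSet E B S))) := by
            gcongr
            exact_mod_cast hm v
        _ = (m * q) * ((β ^ d)⁻¹ * μ.real (goodSet E B S)) := by ring
        _ ≤ ((1 - β) * β ^ d) * ((β ^ d)⁻¹ * μ.real (goodSet E B S)) := by gcongr
        _ = _ := by field_simp
    have := (measureReal_mono hsubset (measure_ne_top μ _)).trans (measureReal_union_le _ _)
    linarith

theorem lll [DecidableEq V] (ν : Measure (Fin M)) [IsProbabilityMeasure ν]
    (E : J → Finset V) (B : J → Set (V → Fin M))
    (hB : ∀ j, ∀ f g : V → Fin M, (∀ x ∈ E j, f x = g x) → f ∈ B j → g ∈ B j)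
    (hBE : ∀ j, E j = ∅ → B j = ∅)
    (inc : V → Finset J) (hinc : ∀ v j, v ∈ E j → j ∈ inc v)
    (d m : ℕ) (hd : ∀ j, #(E j) ≤ d) (hm : ∀ v, #(inc v) ≤ m)
    (q β : ℝ) (hβ : 0 < β) (hβ1 : β ≤ 1) (hq0 : 0 ≤ q)
    (hq : ∀ j, (Measure.infinitePi (fun _ : V => ν)).real (B j) ≤ q)
    (hmq : m * q ≤ (1 - β) * β ^ d) : ∃ f : V → Fin M, ∀ j, f ∉ B j := by
  set μ := Measure.infinitePi (fun _ : V => ν) with hμ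
  have hpos : ∀ S : Finset V, 0 < μ.real (goodSet E B S) := by
    intro S
    induction S using Finset.induction_on with
    | empty =>
      have : goodSet E B ∅ = Set.univ := by
        ext f
        simp only [goodSet, Set.mem_ofPred_eq, Set.mem_univ, iff_true, subset_empty]
        intro j hj
        rw [hBE j hj]; simp
      rw [this]; simp
    | insert x S hx ihS =>
      exact (mul_pos hβ ihS).trans_le
        (lll_step ν E B hB inc hinc d m hd hm q β hβ hβ1 hq0 hq hmq _ S x rfl hx)
  have hne : ((Set.univ : Set (V → Fin M)) ∩ ⋂ j, (B j)ᶜ).Nonempty := by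
    apply isCompact_univ.inter_iInter_nonempty
    · intro j
      exact (dep_clopen (E j) (B j) (hB j)).compl.1
    · intro u
      obtain ⟨f, hf⟩ : (goodSet E B (u.biUnion E)).Nonempty := by
        by_contra h
        rw [Set.not_nonempty_iff_eq_empty] at h
        have := hpos (u.biUnion E)
        rw [h] at this
        simp at this
      refine ⟨f, trivial, ?_⟩
      simp only [Set.mem_iInter]
      intro j hj
      exact hf j (subset_biUnion_of_mem E hj)
  obtain ⟨f, -, hf⟩ := hne
  exact ⟨f, fun j => Set.mem_iInter.1 hf j⟩
end


theorem conc {V : Type} {M : ℕ} (ν : Measure (Fin M)) [IsProbabilityMeasure ν]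
    (C : Set (Fin M)) [DecidablePred (· ∈ C)] (E : Finset V) (d : ℕ) (hd : #E = d) (hd0 : 0 < d) (p : ℝ) (hp : ν.real C = p) :
    (Measure.infinitePi (fun _ : V => ν)).real
      {f | d * p / 2 ≤ |(#(E.filter (fun x => f x ∈ C)) : ℝ) - d * p|} ≤
      2 * Real.exp (-(d * p ^ 2 / 2)) := by
  set μ := Measure.infinitePi (fun _ : V => ν) with hμ
  have hp0 : 0 ≤ p := hp ▸ measureReal_nonneg
  have hdR : (0 : ℝ) < d := by exact_mod_cast hd0
  have hmeas : ∀ g : Fin M → ℝ, Measurable g := fun g => measurable_of_finite g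
  have hint : ∀ v, ∫ f, (C.indicator (fun _ => (1 : ℝ)) (f v)) ∂μ = p := by
    intro v
    have h := integral_map (μ := μ) (φ := fun f : V → Fin M => f v)
      (measurable_pi_apply v).aemeasurable
      (f := C.indicator (fun _ => (1 : ℝ))) (hmeas _).aestronglyMeasurable
    rw [← h]
    have h2 : μ.map (fun f : V → Fin M => f v) = ν := Measure.infinitePi_map_eval (fun _ : V => ν) v
    rw [h2, integral_indicator_const _ (Set.toFinite C).measurableSet]
    simp [hp]
  have hsg : ∀ v, HasSubgaussianMGF
      (fun f : V → Fin M => C.indicator (fun _ => (1 : ℝ)) (f v) - p) ((1 / 2) ^ 2) μ := by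
    intro v
    have := hasSubgaussianMGF_of_mem_Icc (μ := μ) (a := 0) (b := 1)
      (X := fun f : V → Fin M => C.indicator (fun _ => (1 : ℝ)) (f v))
      (Measurable.comp (hmeas (C.indicator (fun _ => (1 : ℝ))))
        (measurable_pi_apply v)).aemeasurable
      (Filter.Eventually.of_forall (fun f => by
        by_cases h : f v ∈ C <;> simp [h]))
    rw [hint v] at this
    simpa using this
  have hind1 : iIndepFun (fun (v : V) (f : V → Fin M) =>
      C.indicator (fun _ => (1 : ℝ)) (f v) - p) μ :=
    iIndepFun_infinitePi (P := fun _ : V => ν)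
      (X := fun _ x => C.indicator (fun _ => (1 : ℝ)) x - p) (fun _ => hmeas _)
  have hind2 : iIndepFun (fun (v : V) (f : V → Fin M) =>
      -(C.indicator (fun _ => (1 : ℝ)) (f v) - p)) μ :=
    iIndepFun_infinitePi (P := fun _ : V => ν)
      (X := fun _ x => -(C.indicator (fun _ => (1 : ℝ)) x - p)) (fun _ => hmeas _)
  have hε : 0 ≤ d * p / 2 := by positivity
  have t1 := HasSubgaussianMGF.measure_sum_ge_le_of_iIndepFun hind1 (s := E)
    (c := fun _ => (1 / 2) ^ 2) (fun v _ => hsg v) hε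
  have t2 := HasSubgaussianMGF.measure_sum_ge_le_of_iIndepFun hind2 (s := E)
    (c := fun _ => (1 / 2) ^ 2) (fun v _ => (hsg v).neg) hε
  have hexp : -(d * p / 2) ^ 2 / (2 * ∑ i ∈ E, ((1 / 2 : ℝ) ^ 2)) =
      -(d * p ^ 2 / 2) := by
    simp only [sum_const, hd, nsmul_eq_mul]
    field_simp
  simp only [NNReal.coe_sum, NNReal.coe_pow, NNReal.coe_div, NNReal.coe_one, NNReal.coe_ofNat] at t1 t2
  rw [hexp] at t1 t2
  have hsum : ∀ f : V → Fin M, ∑ v ∈ E, (C.indicator (fun _ => (1 : ℝ)) (f v) - p) =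
      (#(E.filter (fun x => f x ∈ C)) : ℝ) - d * p := by
    intro f
    rw [sum_sub_distrib, sum_const, hd, nsmul_eq_mul, card_filter]
    push_cast
    congr 1
    refine sum_congr rfl (fun x _ => ?_)
    by_cases h : f x ∈ C <;> simp [h]
  simp only [sum_neg_distrib, hsum] at t1 t2
  have hsub : {f : V → Fin M | d * p / 2 ≤ |(#(E.filter (fun x => f x ∈ C)) : ℝ) - d * p|} ⊆
      {f | d * p / 2 ≤ (#(E.filter (fun x => f x ∈ C)) : ℝ) - d * p} ∪
      {f | d * p / 2 ≤ -((#(E.filter (fun x => f x ∈ C)) : ℝ) - d * p)} := by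
    intro f hf
    exact le_abs.1 (show d * p / 2 ≤ |(#(E.filter (fun x => f x ∈ C)) : ℝ) - d * p| from hf)
  have := (measureReal_mono hsub (measure_ne_top μ _)).trans (measureReal_union_le _ _)
  linarith

theorem exists_unif (M : ℕ) (hM : 0 < M) : ∃ ν : Measure (Fin M), IsProbabilityMeasure ν ∧
    ∀ C : Finset (Fin M), ν.real C = #C / M := by
  have : Nonempty (Fin M) := ⟨⟨0, hM⟩⟩
  refine ⟨uniformOn Set.univ, inferInstance, fun C => ?_⟩
  rw [measureReal_def, uniformOn_univ]
  simp

theorem exists_k0 (t : ℕ) : ∃ k₀ : ℕ, ∀ k : ℕ, k₀ ≤ k →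
    ∀ x : ℝ, (k : ℝ) ^ 2 / (8 * 9 ^ (t - 1)) ≤ x → 
    (32 * t * ((k : ℝ) ^ (2 * t)) ^ 2) * Real.exp (-x) ≤ 1 := by
  set c : ℝ := 1 / (8 * 9 ^ (t - 1)) with hc
  have hc0 : 0 < c := by positivity
  have h1 := (Real.tendsto_pow_mul_exp_neg_atTop_nhds_zero (2 * t)).const_mul (32 * t / c ^ (2 * t))
  have h2 : Filter.Tendsto (fun k : ℕ => c * (k : ℝ) ^ 2) Filter.atTop Filter.atTop :=
    Filter.Tendsto.const_mul_atTop hc0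
      ((Filter.tendsto_pow_atTop two_ne_zero).comp tendsto_natCast_atTop_atTop)
  have h3 := (h1.comp h2).eventually (gt_mem_nhds (show (32 * t / c ^ (2 * t)) * 0 < 1 by simp))
  obtain ⟨k₀, hk⟩ := Filter.eventually_atTop.1 h3
  refine ⟨k₀, fun k hk' x hx => ?_⟩
  have h := (hk k hk').le
  simp only [Function.comp_apply] at h
  refine le_trans ?_ h
  have e : (32 * t / c ^ (2 * t)) * ((c * (k : ℝ) ^ 2) ^ (2 * t) * Real.exp (-(c * (k : ℝ) ^ 2)))
      = (32 * t * ((k : ℝ) ^ (2 * t)) ^ 2) * Real.exp (-(c * (k : ℝ) ^ 2)) := by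
    rw [mul_pow]; field_simp; ring
  rw [e]
  gcongr
  calc c * (k : ℝ) ^ 2 = (k : ℝ) ^ 2 / (8 * 9 ^ (t - 1)) := by rw [hc]; ring
    _ ≤ x := hx

def cls (t k i : ℕ) : Finset (Fin (2 * (3 * k) ^ (t - 1))) :=
  univ.filter (fun x => (3 * k) ^ i ≤ x.1 ∧ x.1 < 2 * (3 * k) ^ i)

theorem card_cls (t k i : ℕ) (hk : 1 ≤ k) (hi : i < t) : #(cls t k i) = (3 * k) ^ i := by
  have h : (cls t k i).map Fin.valEmbedding = Finset.Ico ((3 * k) ^ i) (2 * (3 * k) ^ i) := by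
    ext x
    simp only [cls, mem_map, mem_filter, mem_univ, true_and, mem_Ico, Fin.valEmbedding_apply]
    constructor
    · rintro ⟨a, ha, rfl⟩; exact ha
    · intro hx
      have : (3 * k) ^ i ≤ (3 * k) ^ (t - 1) :=
        Nat.pow_le_pow_right (by omega) (by omega)
      exact ⟨⟨x, by omega⟩, hx, rfl⟩
  rw [← card_map, h, Nat.card_Ico]
  omega

theorem cls_unique (t k i j : ℕ) (hk : 1 ≤ k) (x) (hi : x ∈ cls t k i) (hj : x ∈ cls t k j) :
    i = j := by
  simp only [cls, mem_filter, mem_univ, true_and] at hi hj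
  have key : ∀ a b : ℕ, a < b → (2 * (3 * k) ^ a ≤ (3 * k) ^ b) := by
    intro a b hab
    calc 2 * (3 * k) ^ a ≤ (3 * k) ^ a * (3 * k) := by
          rw [mul_comm]; exact Nat.mul_le_mul_left _ (by omega)
      _ = (3 * k) ^ (a + 1) := (pow_succ _ _).symm
      _ ≤ _ := Nat.pow_le_pow_right (by omega) hab
  rcases lt_trichotomy i j with h | h | h
  · have := key i j h; omega
  · exact h
  · have := key j i h; omega

open Classical in
theorem coloring {α : Type} (D : Digraph' α) (t k : ℕ) (ht : 1 ≤ t) (hk : 1 ≤ k)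
    (hbig : ∀ x : ℝ, (k : ℝ) ^ 2 / (8 * 9 ^ (t - 1)) ≤ x → 
      (32 * t * ((k : ℝ) ^ (2 * t)) ^ 2) * Real.exp (-x) ≤ 1)
    (N : Bool → α → Finset α)
    (hN : ∀ w u, u ∈ N true w ↔ D.Adj w u) (hN' : ∀ w u, u ∈ N false w ↔ D.Adj u w)
    (hcard : ∀ w ∈ D.verts, ∀ b, #(N b w) = k ^ (2 * t)) :
    ∃ f : α → Fin (2 * (3 * k) ^ (t - 1)), ∀ w ∈ D.verts, ∀ b, ∀ i < t,
      |(#((N b w).filter (fun x => f x ∈ cls t k i)) : ℝ) -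
        (k ^ (2 * t) : ℕ) * ((3 * k : ℝ) ^ i / (2 * (3 * k : ℝ) ^ (t - 1)))| <
        (k ^ (2 * t) : ℕ) * ((3 * k : ℝ) ^ i / (2 * (3 * k : ℝ) ^ (t - 1))) / 2 := by
  set d := k ^ (2 * t) with hd
  have hd0 : 0 < d := by positivity
  obtain ⟨ν, hν, hνC⟩ := exists_unif (2 * (3 * k) ^ (t - 1)) (by positivity)
  set p : ℕ → ℝ := fun i => (3 * k : ℝ) ^ i / (2 * (3 * k : ℝ) ^ (t - 1)) with hp
  have hνp : ∀ i < t, ν.real (cls t k i : Set _) = p i := by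
    intro i hi
    rw [hνC, card_cls t k i hk hi]
    push_cast
    rfl
  have hempty : ∀ w, w ∉ D.verts → ∀ b, N b w = ∅ := by
    intro w hw b
    refine Finset.eq_empty_of_forall_notMem (fun u hu => hw ?_)
    cases b
    · exact D.mem_verts_right ((hN' w u).1 hu)
    · exact D.mem_verts_left ((hN w u).1 hu)
  have hcle : ∀ w b, #(N b w) ≤ d := by
    intro w b
    by_cases hw : w ∈ D.verts
    · exact (hcard w hw b).le
    · rw [hempty w hw b]; simp
  have hdR : (1 : ℝ) ≤ d := by exact_mod_cast hd0
  have hkR : (1 : ℝ) ≤ k := by exact_mod_cast hk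
  have hx : ∀ i, (k : ℝ) ^ 2 / (8 * 9 ^ (t - 1)) ≤ d * p i ^ 2 / 2 := by
    intro i
    have h1 : 1 / (2 * (3 * k : ℝ) ^ (t - 1)) ≤ p i := by
      simp only [hp]
      gcongr
      exact one_le_pow₀ (by linarith)
    have h2 : (k : ℝ) ^ 2 / (8 * 9 ^ (t - 1)) = d * (1 / (2 * (3 * k : ℝ) ^ (t - 1))) ^ 2 / 2 := by
      obtain ⟨s, rfl⟩ : ∃ s, t = s + 1 := ⟨t - 1, by omega⟩
      have h9 : (9 : ℝ) ^ s = (3 ^ s) ^ 2 := by rw [← pow_mul, mul_comm, pow_mul]; norm_num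
      simp only [hd, Nat.add_sub_cancel, mul_pow, div_pow, h9]
      push_cast
      field_simp
      ring
    rw [h2]
    gcongr
  set E : α × Fin t × Bool → Finset α := fun j => N j.2.2 j.1 with hE
  set B : α × Fin t × Bool → Set (α → Fin (2 * (3 * k) ^ (t - 1))) := fun j =>
    {f | j.1 ∈ D.verts ∧ d * p j.2.1 / 2 ≤
      |(#((E j).filter (fun x => f x ∈ (cls t k j.2.1 : Set _))) : ℝ) - d * p j.2.1|} with hBdef
  have main := lll ν E B ?_ ?_ (fun v => (N true v ∪ N false v) ×ˢ univ) ?_ d (4 * d * t)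
    (fun j => hcle _ _) ?_ (2 * Real.exp (-((k : ℝ) ^ 2 / (8 * 9 ^ (t - 1))))) (1 - 1 / (2 * d))
    ?_ ?_ (by positivity) ?_ ?_
  · obtain ⟨f, hf⟩ := main
    refine ⟨f, fun w hw b i hi => ?_⟩
    have := hf (w, ⟨i, hi⟩, b)
    by_contra hcon
    rw [not_lt] at hcon
    exact this ⟨hw, by simpa [hE] using hcon⟩
  · rintro j f g hfg ⟨hj, hf⟩
    refine ⟨hj, ?_⟩
    have : (E j).filter (fun x => g x ∈ (cls t k j.2.1 : Set _)) =
        (E j).filter (fun x => f x ∈ (cls t k j.2.1 : Set _)) :=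
      filter_congr (fun x hx => by rw [hfg x hx])
    rw [this]; exact hf
  · intro j hj
    rw [Set.eq_empty_iff_forall_notMem]
    rintro f ⟨hj', -⟩
    have := hcard j.1 hj' j.2.2
    have h0 : N j.2.2 j.1 = ∅ := hj
    rw [h0] at this
    simp at this
    omega
  · rintro v ⟨w, i, b⟩ hv
    simp only [mem_product, mem_univ, and_true, mem_union]
    cases b
    · left; exact (hN v w).2 ((hN' w v).1 hv)
    · right; exact (hN' v w).2 ((hN w v).1 hv)
  · intro v
    rw [card_product]
    have h1 := card_union_le (N true v) (N false v)
    have h2 := hcle v true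
    have h3 := hcle v false
    calc _ ≤ (2 * d) * (t * 2) := by
          apply Nat.mul_le_mul (by omega)
          simp
      _ = _ := by ring
  · have : 1 / (2 * (d : ℝ)) ≤ 1 / 2 := by
      apply one_div_le_one_div_of_le <;> linarith
    linarith
  · have : 0 ≤ 1 / (2 * (d : ℝ)) := by positivity
    linarith
  · intro j
    by_cases hj : j.1 ∈ D.verts
    · have h1 := conc ν (cls t k j.2.1 : Set _) (E j) d (hcard _ hj _) hd0 (p j.2.1)
        (hνp _ j.2.1.2)
      have h2 : B j ⊆ {f | d * p j.2.1 / 2 ≤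
          |(#((E j).filter (fun x => f x ∈ (cls t k j.2.1 : Set _))) : ℝ) - d * p j.2.1|} :=
        fun f hf => hf.2
      refine (measureReal_mono h2 (measure_ne_top _ _)).trans (h1.trans ?_)
      have := hx j.2.1
      gcongr
    · have : B j = ∅ := by
        rw [Set.eq_empty_iff_forall_notMem]
        rintro f ⟨hj', -⟩
        exact hj hj'
      rw [this, measureReal_empty]; positivity
  · have h1 := hbig _ le_rfl
    have hb : (1 : ℝ) / 2 ≤ (1 - 1 / (2 * d)) ^ d := by
      have h := one_add_mul_le_pow (a := -(1 / (2 * (d : ℝ)))) (by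
        have : 1 / (2 * (d : ℝ)) ≤ 1 / 2 := by
          apply one_div_le_one_div_of_le <;> linarith
        linarith) d
      have e : 1 + (d : ℝ) * -(1 / (2 * d)) = 1 / 2 := by field_simp; ring
      rw [e] at h
      simpa [sub_eq_add_neg] using h
    have hdd : ((k : ℝ) ^ (2 * t)) = d := by rw [hd]; push_cast; rfl
    rw [hdd] at h1
    calc _ = (32 * t * (d : ℝ) ^ 2 * Real.exp (-((k : ℝ) ^ 2 / (8 * 9 ^ (t - 1))))) *
          (1 / (2 * d) * (1 / 2)) := by push_cast; field_simp; ring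
      _ ≤ 1 * (1 / (2 * d) * (1 / 2)) := by gcongr
      _ ≤ (1 - (1 - 1 / (2 * d))) * (1 - 1 / (2 * d)) ^ d := by
        rw [one_mul, sub_sub_cancel]
        gcongr

end Helpers

/-- For `k` sufficiently large as a function of `t`, every `k^{2t}`-regular
digraph `D` has a subdigraph `D'` of minimum out-degree at least `k` together
with a partition `(V_1, …, V_t)` of `V(D')` (here `P 0, …, P (t-1)`) such that
every arc of `D'` goes from `P i` to `P ((i+1) % t)` for some `i < t`, and
every vertex outside `P 0` has in-degree at most 1 in `D'`. -/
theorem regular_partition_lemma :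
    ∀ t : ℕ, 1 ≤ t → ∃ k₀ : ℕ, ∀ k : ℕ, k₀ ≤ k →
      ∀ (α : Type) (D : Digraph' α), D.verts.Nonempty →
        IsRegularDigraph D (k ^ (2 * t)) →
        ∃ (D' : Digraph' α) (P : ℕ → Set α), D'.IsSubdigraph D ∧
          D'.verts.Nonempty ∧ D'.MinOutDegAtLeast k ∧
          (∀ i j : ℕ, i < t → j < t → i ≠ j → Disjoint (P i) (P j)) ∧
          (⋃ i ∈ Finset.range t, P i) = D'.verts ∧
          (∀ ⦃u v : α⦄, D'.Adj u v →
            ∃ i : ℕ, i < t ∧ u ∈ P i ∧ v ∈ P ((i + 1) % t)) ∧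
          ∀ v ∈ D'.verts, v ∉ P 0 → (D'.inNbrs v).Subsingleton := by
  intro t ht
  classical
  obtain ⟨k₁, hk₁⟩ := exists_k0 t
  refine ⟨max k₁ 12, fun k hk α D hne hreg => ?_⟩
  have hk12 : 12 ≤ k := (le_max_right _ _).trans hk
  have hk1 : 1 ≤ k := by omega
  have hkR : (12 : ℝ) ≤ k := by exact_mod_cast hk12
  have hfin : ∀ w, (D.outNbrs w).Finite ∧ (D.inNbrs w).Finite := by
    intro w
    by_cases hw : w ∈ D.verts
    · exact ⟨(hreg w hw).1.1, (hreg w hw).2.1⟩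
    · have h1 : D.outNbrs w = ∅ :=
        Set.eq_empty_iff_forall_notMem.2 (fun u hu => hw (D.mem_verts_left hu))
      have h2 : D.inNbrs w = ∅ :=
        Set.eq_empty_iff_forall_notMem.2 (fun u hu => hw (D.mem_verts_right hu))
      rw [h1, h2]; exact ⟨Set.finite_empty, Set.finite_empty⟩
  set N : Bool → α → Finset α := fun b w =>
    if b then (hfin w).1.toFinset else (hfin w).2.toFinset with hNdef
  have hN : ∀ w u, u ∈ N true w ↔ D.Adj w u := by
    intro w u; simp [hNdef, outNbrs]
  have hN' : ∀ w u, u ∈ N false w ↔ D.Adj u w := by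
    intro w u; simp [hNdef, inNbrs]
  have hcard : ∀ w ∈ D.verts, ∀ b, (N b w).card = k ^ (2 * t) := by
    intro w hw b
    cases b
    · have := (hreg w hw).2.2
      rw [Set.ncard_eq_toFinset_card _ (hfin w).2] at this
      simpa [hNdef] using this
    · have := (hreg w hw).1.2
      rw [Set.ncard_eq_toFinset_card _ (hfin w).1] at this
      simpa [hNdef] using this
  obtain ⟨f, hf⟩ := coloring D t k ht hk1 (hk₁ k ((le_max_left _ _).trans hk)) N hN hN' hcard
  set y : ℕ → ℝ := fun i =>
    (k ^ (2 * t) : ℕ) * ((3 * k : ℝ) ^ i / (2 * (3 * k : ℝ) ^ (t - 1))) with hy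
  have hlow : ∀ w ∈ D.verts, ∀ b, ∀ i < t,
      y i / 2 < ((N b w).filter (fun x => f x ∈ cls t k i)).card := by
    intro w hw b i hi
    have := (abs_lt.1 (hf w hw b i hi)).1
    simp only [hy] at *
    linarith
  have hupp : ∀ w ∈ D.verts, ∀ b, ∀ i < t,
      (((N b w).filter (fun x => f x ∈ cls t k i)).card : ℝ) < 3 * y i / 2 := by
    intro w hw b i hi
    have := (abs_lt.1 (hf w hw b i hi)).2
    simp only [hy] at *
    linarith
  have hysucc : ∀ i, y (i + 1) = 3 * k * y i := by
    intro i; simp only [hy, pow_succ]; ring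
  have hy0 : 2 * (k : ℝ) ≤ y 0 := by
    obtain ⟨s, rfl⟩ : ∃ s, t = s + 1 := ⟨t - 1, by omega⟩
    simp only [hy, pow_zero, Nat.add_sub_cancel]
    push_cast
    rw [mul_one_div, le_div_iff₀ (by positivity)]
    have h3 : (3 : ℝ) ^ s * 4 ≤ k ^ (s + 1) := by
      rw [pow_succ]
      exact mul_le_mul (pow_le_pow_left₀ (by norm_num) (by linarith) s) (by linarith)
        (by norm_num) (by positivity)
    calc 2 * (k : ℝ) * (2 * (3 * k) ^ s) = (3 ^ s * 4) * k ^ (s + 1) := by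
          rw [mul_pow, pow_succ]; ring
      _ ≤ k ^ (s + 1) * k ^ (s + 1) := by gcongr
      _ = k ^ (2 * (s + 1)) := by ring
  have hyk : ∀ i, 2 * (k : ℝ) ≤ y i := by
    intro i
    induction i with
    | zero => exact hy0
    | succ i ih => rw [hysucc]; nlinarith
  have hout : ∀ w ∈ D.verts, ∀ i < t,
      k ≤ ((N true w).filter (fun x => f x ∈ cls t k i)).card := by
    intro w hw i hi
    have h1 := hlow w hw true i hi
    have h2 := hyk i
    have : (k : ℝ) ≤ ((N true w).filter (fun x => f x ∈ cls t k i)).card := by linarith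
    exact_mod_cast this
  set P : ℕ → Set α := fun i => {u | u ∈ D.verts ∧ f u ∈ cls t k i} with hP
  have hPu : ∀ i j u, u ∈ P i → u ∈ P j → i = j := fun i j u hi hj =>
    cls_unique t k i j hk1 (f u) hi.2 hj.2
  have hF : ∀ i, ∃ F : P i → Fin k → α, i + 1 < t →
      (∀ (u : P i) (a : Fin k), F u a ∈ (N true (u : α)).filter (fun x => f x ∈ cls t k (i + 1))) ∧
      ∀ u a u' a', F u a = F u' a' → u = u' ∧ a = a' := by
    intro i
    by_cases hi : i + 1 < t
    swap
    · exact ⟨fun u _ => u, fun h => absurd h hi⟩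
    have hfl : (⌊3 * y i / 2⌋₊ : ℝ) ≤ 3 * y i / 2 := Nat.floor_le (by have := hyk i; linarith)
    obtain ⟨F, hF⟩ := hall_lemma (P i)
      (fun u => (N true u).filter (fun x => f x ∈ cls t k (i + 1))) k ⌊3 * y i / 2⌋₊
      (Nat.floor_pos.2 (by have := hyk i; linarith))
      (by
        intro u hu
        have h1 := hlow u hu.1 true (i + 1) hi
        rw [hysucc] at h1
        have h2 : ((k * ⌊3 * y i / 2⌋₊ : ℕ) : ℝ) ≤
            ((N true u).filter (fun x => f x ∈ cls t k (i + 1))).card := by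
          push_cast
          have : (k : ℝ) * ⌊3 * y i / 2⌋₊ ≤ k * (3 * y i / 2) := by gcongr
          linarith
        exact_mod_cast h2)
      (by
        intro v S hS
        by_cases hv : v ∈ D.verts
        · have h1 := hupp v hv false i (by omega)
          refine le_trans (Finset.card_le_card ?_) (Nat.le_floor h1.le)
          intro u hu
          simp only [Finset.mem_filter] at hu ⊢
          exact ⟨(hN' v u).2 ((hN u v).1 hu.2.1), (hS hu.1).2⟩
        · rw [Finset.filter_false_of_mem]
          · simp
          · intro u _ hu
            exact hv (D.mem_verts_right ((hN u v).1 (Finset.mem_filter.1 hu).1)))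
    exact ⟨F, fun _ => hF⟩
  choose F hF using hF
  refine ⟨{
    verts := ⋃ i ∈ Finset.range t, P i
    Adj := fun u v => D.Adj u v ∧ ∃ i, i < t ∧ v ∈ P ((i + 1) % t) ∧
      ∃ hu : u ∈ P i, (i + 1 < t → ∃ a, F i ⟨u, hu⟩ a = v)
    ne_of_adj := fun u v h => D.ne_of_adj h.1
    mem_verts_left := ?_
    mem_verts_right := ?_ }, P, ⟨?_, ?_⟩, ?_, ?_, ?_, rfl, ?_, ?_⟩
  · rintro u v ⟨_, i, hi, _, hu, _⟩
    simp only [Set.mem_iUnion, Finset.mem_range]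
    exact ⟨i, hi, hu⟩
  · rintro u v ⟨_, i, hi, hv, _⟩
    simp only [Set.mem_iUnion, Finset.mem_range]
    exact ⟨_, Nat.mod_lt _ (by omega), hv⟩
  · intro u hu
    simp only [Set.mem_iUnion] at hu
    obtain ⟨i, _, hu⟩ := hu
    exact hu.1
  · intro u v h
    exact h.1
  · obtain ⟨w, hw⟩ := hne
    have h := hout w hw 0 (by omega)
    obtain ⟨u, hu⟩ := Finset.card_pos.1 (lt_of_lt_of_le hk1 h)
    rw [Finset.mem_filter] at hu
    refine ⟨u, ?_⟩
    simp only [Set.mem_iUnion, Finset.mem_range]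
    exact ⟨0, by omega, D.mem_verts_right ((hN w u).1 hu.1), hu.2⟩
  · intro u hu
    simp only [Set.mem_iUnion, Finset.mem_range] at hu
    obtain ⟨i, hi, hu⟩ := hu
    by_cases hi' : i + 1 < t
    · obtain ⟨h1, h2⟩ := hF i hi'
      refine ⟨Finset.univ.image (F i ⟨u, hu⟩), ?_, ?_⟩
      · intro v hv
        simp only [Finset.coe_image, Finset.coe_univ, Set.image_univ, Set.mem_range] at hv
        obtain ⟨a, rfl⟩ := hv
        have h3 := Finset.mem_filter.1 (h1 ⟨u, hu⟩ a)
        have h4 := (hN _ _).1 h3.1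
        refine ⟨h4, i, hi, ?_, hu, fun _ => ⟨a, rfl⟩⟩
        rw [Nat.mod_eq_of_lt hi']
        exact ⟨D.mem_verts_right h4, h3.2⟩
      · rw [Finset.card_image_of_injective _ (fun a a' h => (h2 _ _ _ _ h).2)]
        simp
    · refine ⟨_, ?_, hout u hu.1 0 (by omega)⟩
      intro v hv
      have h3 := Finset.mem_filter.1 (Finset.mem_coe.1 hv)
      have h4 := (hN _ _).1 h3.1
      refine ⟨h4, i, hi, ?_, hu, fun h => absurd h hi'⟩
      have : i + 1 = t := by omega
      rw [this, Nat.mod_self]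
      exact ⟨D.mem_verts_right h4, h3.2⟩
  · intro i j _ _ hij
    rw [Set.disjoint_left]
    intro u hu hu'
    exact hij (hPu i j u hu hu')
  · rintro u v ⟨_, i, hi, hv, hu, _⟩
    exact ⟨i, hi, hu, hv⟩
  · rintro v _ hv0 u ⟨_, i, hi, hv, hu, ha⟩ u' ⟨_, j, hj, hv', hu', ha'⟩
    have key : ∀ i, i < t → v ∈ P ((i + 1) % t) → i + 1 < t := by
      intro i hi hv
      by_contra h
      have : i + 1 = t := by omega
      rw [this, Nat.mod_self] at hv
      exact hv0 hv
    have hi' := key i hi hv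
    have hj' := key j hj hv'
    rw [Nat.mod_eq_of_lt hi'] at hv
    rw [Nat.mod_eq_of_lt hj'] at hv'
    have hij : i = j := by
      have := hPu _ _ v hv hv'
      omega
    subst hij
    obtain ⟨a, ha⟩ := ha hi'
    obtain ⟨a', ha'⟩ := ha' hi'
    have := ((hF i hi').2 _ _ _ _ (ha.trans ha'.symm)).1
    simpa using this
end

section
/- Let t be a positive integer, let k be sufficiently large as a function of t, set d = k^{2t} and p_i = ((1 − (6k)^{-1})/(1 − (6k)^{-t}))·(6k)^{i−t} for 1 ≤ i ≤ t, and let D be a d-regular digraph. Then there exists a partition (V_1,…,V_t) of V(D) such that for every vertex v ∈ V(D) and every 1 ≤ i ≤ t, the number of out-neighbors of v in V_i is at least p_i·d/2 and the number of in-neighbors of v in V_i is at most 3·p_i·d/2. -/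
open Digraph'

open MeasureTheory ProbabilityTheory in
theorem symm_lll {Ω ι : Type*} [MeasurableSpace Ω] (P : Measure Ω) [IsProbabilityMeasure P]
    [DecidableEq ι] (A : ι → Set Ω) (hA : ∀ j, MeasurableSet (A j)) (Γ : ι → Finset ι)
    (D : ℕ) (hcard : ∀ j, (Γ j).card ≤ D) (p : ℝ) (hp : ∀ j, P.real (A j) ≤ p)
    (h4 : 4 * p * D ≤ 1) (hp2 : p < 1 / 2) (hp0 : 0 ≤ p)
    (hind : ∀ j (S : Finset ι), Disjoint S (Γ j) →
      P.real (A j ∩ ⋂ l ∈ S, (A l)ᶜ) = P.real (A j) * P.real (⋂ l ∈ S, (A l)ᶜ)) :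
    ∀ S : Finset ι, 0 < P.real (⋂ l ∈ S, (A l)ᶜ) := by
  have hm : ∀ S : Finset ι, MeasurableSet (⋂ l ∈ S, (A l)ᶜ) := fun S =>
    S.measurableSet_biInter fun l _ => (hA l).compl
  have key : ∀ S : Finset ι, ∀ j,
      P.real (A j ∩ ⋂ l ∈ S, (A l)ᶜ) ≤ 2 * p * P.real (⋂ l ∈ S, (A l)ᶜ) := by
    intro S
    induction S using Finset.strongInduction with
    | H S ih =>
    intro j
    set S1 := S.filter (· ∈ Γ j) with hS1
    set S2 := S.filter (· ∉ Γ j) with hS2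
    have hdisj : Disjoint S2 (Γ j) := by
      rw [Finset.disjoint_left]; intro a ha; exact (Finset.mem_filter.mp ha).2
    have hi := hind j S2 hdisj
    have h0 : 0 ≤ P.real (⋂ l ∈ S2, (A l)ᶜ) := measureReal_nonneg
    by_cases hE : S2 = S
    · rw [hE] at hi h0
      rw [hi]
      have := hp j
      nlinarith
    · have hss : S2 ⊂ S := lt_of_le_of_ne (Finset.filter_subset _ _) hE
      have h1 : P.real (A j ∩ ⋂ l ∈ S, (A l)ᶜ) ≤ P.real (A j ∩ ⋂ l ∈ S2, (A l)ᶜ) := by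
        refine measureReal_mono ?_
        apply Set.inter_subset_inter_right
        exact Set.biInter_subset_biInter_left (fun x hx => Finset.filter_subset _ _ hx)
      have hcov : (⋂ l ∈ S2, (A l)ᶜ) ⊆
          (⋂ l ∈ S, (A l)ᶜ) ∪ ⋃ l ∈ S1, (A l ∩ ⋂ m ∈ S2, (A m)ᶜ) := by
        intro x hx
        by_cases hx' : x ∈ ⋂ l ∈ S, (A l)ᶜ
        · exact Or.inl hx'
        · right
          simp only [Set.mem_iInter, not_forall, Set.mem_compl_iff, not_not] at hx'
          obtain ⟨l, hl, hxl⟩ := hx'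
          have : l ∈ S1 := by
            by_contra hc
            have h2 : l ∈ S2 := by
              simp only [hS1, hS2, Finset.mem_filter] at hc ⊢; tauto
            exact (Set.mem_iInter₂.mp hx l h2) hxl
          exact Set.mem_iUnion₂.mpr ⟨l, this, hxl, hx⟩
      have h2 : P.real (⋂ l ∈ S2, (A l)ᶜ) ≤ P.real (⋂ l ∈ S, (A l)ᶜ) +
          ∑ l ∈ S1, P.real (A l ∩ ⋂ m ∈ S2, (A m)ᶜ) :=
        (measureReal_mono hcov).trans ((measureReal_union_le _ _).trans
          (by gcongr; exact measureReal_biUnion_finset_le _ _))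
      have h3 : ∑ l ∈ S1, P.real (A l ∩ ⋂ m ∈ S2, (A m)ᶜ) ≤
          S1.card * (2 * p * P.real (⋂ l ∈ S2, (A l)ᶜ)) := by
        rw [← nsmul_eq_mul]
        exact Finset.sum_le_card_nsmul _ _ _ fun l _ => ih S2 hss l
      have h4' : (S1.card : ℝ) ≤ D := by
        have : S1.card ≤ (Γ j).card :=
          Finset.card_le_card fun x hx => (Finset.mem_filter.mp hx).2
        exact_mod_cast this.trans (hcard j)
      have h5 : (S1.card : ℝ) * (2 * p * P.real (⋂ l ∈ S2, (A l)ᶜ)) ≤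
          D * (2 * p * P.real (⋂ l ∈ S2, (A l)ᶜ)) := by gcongr
      have h6 : (D : ℝ) * (2 * p * P.real (⋂ l ∈ S2, (A l)ᶜ)) ≤
          1 / 2 * P.real (⋂ l ∈ S2, (A l)ᶜ) := by nlinarith
      have h7 : P.real (A j) * P.real (⋂ l ∈ S2, (A l)ᶜ) ≤
          p * P.real (⋂ l ∈ S2, (A l)ᶜ) := by gcongr; exact hp j
      have h8 : P.real (⋂ l ∈ S2, (A l)ᶜ) ≤ 2 * P.real (⋂ l ∈ S, (A l)ᶜ) := by linarith
      have h9 := mul_le_mul_of_nonneg_left h8 hp0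
      linarith
  intro S
  induction S using Finset.induction_on with
  | empty => simp
  | insert a S ha ih =>
    have h1 := key S a
    have h2 : P.real (⋂ l ∈ S, (A l)ᶜ) = P.real (A a ∩ ⋂ l ∈ S, (A l)ᶜ) +
        P.real (⋂ l ∈ insert a S, (A l)ᶜ) := by
      rw [Finset.set_biInter_insert, ← measureReal_inter_add_sdiff (s := ⋂ l ∈ S, (A l)ᶜ) (hA a)]
      congr 2
      · exact Set.inter_comm _ _
      · rw [Set.sdiff_eq, Set.inter_comm]
    nlinarith

open MeasureTheory ProbabilityTheory in
theorem hoeff_color {α : Type*} {t : ℕ} (ν : Measure (Fin t)) [IsProbabilityMeasure ν]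
    (N : Finset α) (d : ℕ) (hd : 0 < d) (hN : N.card ≤ d) (c : Fin t) (q : ℝ)
    (hq : ν.real {c} = q) (hq0 : 0 < q) :
    (Measure.infinitePi (fun _ : α => ν)).real
      {ω | q * d / 2 < |(∑ u ∈ N, if ω u = c then (1 : ℝ) else 0) - q * N.card|} ≤
      2 * Real.exp (- (q ^ 2 * d / 2)) := by
  set P := Measure.infinitePi (fun _ : α => ν) with hP
  let g : Fin t → ℝ := fun x => if x = c then 1 else 0
  have hg : Measurable g := measurable_of_finite g
  have hint : ∀ u : α, ∫ ω : α → Fin t, g (ω u) ∂P = q := by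
    intro u
    have hmp := measurePreserving_eval_infinitePi (fun _ : α => ν) u
    have : ∫ x, g x ∂ν = q := by
      have : g = Set.indicator {c} 1 := by
        ext x; simp [g, Set.indicator_apply]
      rw [this, integral_indicator_one (measurableSet_singleton c), hq]
    rw [← this, ← hmp.map_eq, integral_map hmp.measurable.aemeasurable (by fun_prop)]
  have hind : iIndepFun (fun (u : α) (ω : α → Fin t) => g (ω u) - q) P :=
    iIndepFun_infinitePi (X := fun _ x => g x - q) (by fun_prop)
  have hsub : ∀ u ∈ N, HasSubgaussianMGF (fun ω : α → Fin t => g (ω u) - q)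
      ((‖(1 : ℝ) - 0‖₊ / 2) ^ 2) P := by
    intro u _
    have := hasSubgaussianMGF_of_mem_Icc (μ := P) (X := fun ω : α → Fin t => g (ω u))
      (a := 0) (b := 1) (hg.comp (measurable_pi_apply u)).aemeasurable (ae_of_all _ fun ω => by
        simp only [g]; split_ifs <;> simp)
    rwa [hint u] at this
  have hs := HasSubgaussianMGF.sum_of_iIndepFun hind hsub
  have hdpos : (0 : ℝ) < d := by exact_mod_cast hd
  have hε : 0 < q * d / 2 := by positivity
  have hsum : ∀ ω : α → Fin t, ∑ u ∈ N, (g (ω u) - q) =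
      (∑ u ∈ N, if ω u = c then (1 : ℝ) else 0) - q * N.card := by
    intro ω; rw [Finset.sum_sub_distrib]; simp [g, mul_comm]
  rcases Finset.eq_empty_or_nonempty N with rfl | hne
  · have : {ω : α → Fin t | q * d / 2 < |(∑ u ∈ (∅ : Finset α), if ω u = c then (1 : ℝ) else 0) -
        q * (∅ : Finset α).card|} = ∅ := by
      ext ω; simp; positivity
    rw [this]; simp; positivity
  have hcpos : (0 : ℝ) < N.card := by exact_mod_cast hne.card_pos
  have hcd : (N.card : ℝ) ≤ d := by exact_mod_cast hN
  have hexp : Real.exp (-(q * d / 2) ^ 2 /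
      (2 * ((∑ i ∈ N, (‖(1 : ℝ) - 0‖₊ / 2) ^ 2 : NNReal) : ℝ))) ≤
      Real.exp (- (q ^ 2 * d / 2)) := by
    apply Real.exp_le_exp.mpr
    have : 2 * ((∑ i ∈ N, (‖(1 : ℝ) - 0‖₊ / 2) ^ 2 : NNReal) : ℝ) = N.card / 2 := by
      simp; ring
    rw [this, neg_div]
    apply neg_le_neg
    rw [le_div_iff₀ (by positivity)]
    have : q ^ 2 * d * N.card ≤ q ^ 2 * d * d := by gcongr
    nlinarith
  have b1 := (hs.measure_ge_le hε.le).trans hexp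
  have b2 := (hs.neg.measure_ge_le hε.le).trans hexp
  have hsubset : {ω : α → Fin t | q * d / 2 <
      |(∑ u ∈ N, if ω u = c then (1 : ℝ) else 0) - q * N.card|} ⊆
      {ω | q * d / 2 ≤ ∑ u ∈ N, (g (ω u) - q)} ∪
      {ω | q * d / 2 ≤ (-fun ω : α → Fin t => ∑ u ∈ N, (g (ω u) - q)) ω} := by
    intro ω hω
    simp only [Set.mem_ofPred_eq, ← hsum] at hω
    rcases lt_abs.mp hω with h | h
    · exact Or.inl h.le
    · exact Or.inr h.le
  calc _ ≤ _ := measureReal_mono hsubset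
    _ ≤ _ := measureReal_union_le _ _
    _ ≤ _ := by rw [two_mul]; exact add_le_add b1 b2

open MeasureTheory ProbabilityTheory in
theorem core_coloring {α : Type*} {t : ℕ} (N : α → Bool → Finset α)
    (hsym : ∀ u v b, u ∈ N v b → v ∈ N u (!b)) (d : ℕ) (hd : 0 < d)
    (hN : ∀ v b, (N v b).card ≤ d) (q : Fin t → ℝ) (hq0 : ∀ c, 0 < q c) (hq1 : ∑ c, q c = 1)
    (p : ℝ) (hp : ∀ c, 2 * Real.exp (- (q c ^ 2 * d / 2)) ≤ p)
    (h4 : 4 * p * ((d * (2 * (d * t)) : ℕ) : ℝ) ≤ 1) (hp2 : p < 1 / 2) (hp0 : 0 ≤ p) :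
    ∃ f : α → Fin t, ∀ v b c,
      |(∑ u ∈ N v b, if f u = c then (1 : ℝ) else 0) - q c * (N v b).card| ≤ q c * d / 2 := by
  classical
  let pm : PMF (Fin t) := PMF.ofFintype (fun c => ENNReal.ofReal (q c)) (by
    rw [← ENNReal.ofReal_sum_of_nonneg (fun c _ => (hq0 c).le), hq1, ENNReal.ofReal_one])
  let ν := pm.toMeasure
  have hν : ∀ c, ν.real {c} = q c := by
    intro c
    rw [Measure.real, PMF.toMeasure_apply_singleton _ _ (measurableSet_singleton c)]
    simp [pm, (hq0 c).le]
  let P := Measure.infinitePi (fun _ : α => ν)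
  -- the bad event as a function of the coordinates in `N v b`
  let B : (e : α × Bool × Fin t) → Set ((N e.1 e.2.1) → Fin t) := fun e =>
    {ω | q e.2.2 * d / 2 < |(∑ u, if ω u = e.2.2 then (1 : ℝ) else 0) -
      q e.2.2 * (N e.1 e.2.1).card|}
  let A : α × Bool × Fin t → Set (α → Fin t) := fun e =>
    {ω | q e.2.2 * d / 2 < |(∑ u ∈ N e.1 e.2.1, if ω u = e.2.2 then (1 : ℝ) else 0) -
      q e.2.2 * (N e.1 e.2.1).card|}
  have hAB : ∀ e, A e = (fun (ω : α → Fin t) (u : N e.1 e.2.1) => ω u) ⁻¹' B e := by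
    intro e
    ext ω
    simp only [A, B, Set.mem_ofPred_eq, Set.mem_preimage]
    rw [Finset.sum_coe_sort (N e.1 e.2.1) (fun u => if ω u = e.2.2 then (1 : ℝ) else 0)]
  have hAm : ∀ e, MeasurableSet (A e) := by
    intro e
    rw [hAB]
    exact (Measurable.of_discrete (f := fun x : (N e.1 e.2.1 → Fin t) => x ∈ B e)).setOf.preimage
      (by fun_prop)
  let Γ : α × Bool × Fin t → Finset (α × Bool × Fin t) := fun e =>
    (N e.1 e.2.1).biUnion fun u => (Finset.univ : Finset Bool).biUnion fun b =>
      (N u (!b) ×ˢ ({b} : Finset Bool) ×ˢ (Finset.univ : Finset (Fin t)))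
  have hΓ : ∀ e, (Γ e).card ≤ d * (2 * (d * t)) := by
    intro e
    refine (Finset.card_biUnion_le_card_mul _ _ (2 * (d * t)) fun u _ => ?_).trans
      (Nat.mul_le_mul_right _ (hN _ _))
    refine (Finset.card_biUnion_le_card_mul _ _ (d * t) fun b _ => ?_).trans (by simp)
    simp only [Finset.card_product, Finset.card_singleton, Finset.card_univ, Fintype.card_fin,
      one_mul]
    exact Nat.mul_le_mul_right _ (hN _ _)
  have hiI : iIndepFun (fun (u : α) (ω : α → Fin t) => ω u) P :=
    iIndepFun_infinitePi (X := fun _ x => x) (by fun_prop)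
  have hlll := symm_lll P A hAm Γ (d * (2 * (d * t))) hΓ p
    (fun e => (hoeff_color ν (N e.1 e.2.1) d hd (hN _ _) e.2.2 (q e.2.2) (hν _) (hq0 _)).trans
      (hp _)) h4 hp2 hp0 (by
    intro e S hS
    let T : Finset α := S.biUnion fun l => N l.1 l.2.1
    have hT : Disjoint (N e.1 e.2.1) T := by
      rw [Finset.disjoint_left]
      intro u hu huT
      obtain ⟨l, hl, hul⟩ := Finset.mem_biUnion.mp huT
      refine Finset.disjoint_left.mp hS hl ?_
      simp only [Γ, Finset.mem_biUnion]
      refine ⟨u, hu, l.2.1, Finset.mem_univ _, ?_⟩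
      simp only [Finset.mem_product, Finset.mem_singleton, Finset.mem_univ, and_true]
      exact hsym _ _ _ hul
    have hIF := hiI.indepFun_finset _ _ hT (fun u => by fun_prop)
    let C : Set (T → Fin t) := {x | ∀ l (hl : l ∈ S),
      (fun u : N l.1 l.2.1 => x ⟨u, Finset.mem_biUnion.mpr ⟨l, hl, u.2⟩⟩) ∉ B l}
    have hC : (⋂ l ∈ S, (A l)ᶜ) = (fun (ω : α → Fin t) (u : T) => ω u) ⁻¹' C := by
      ext ω
      simp only [Set.mem_iInter, hAB, Set.mem_compl_iff, Set.mem_preimage, C, Set.mem_ofPred_eq]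
    have := hIF.measure_inter_preimage_eq_mul (B e) C
      (Measurable.of_discrete (f := fun x : (N e.1 e.2.1 → Fin t) => x ∈ B e)).setOf
      (Measurable.of_discrete (f := fun x : (T → Fin t) => x ∈ C)).setOf
    rw [hC, hAB]
    simp only [Measure.real]
    rw [this, ENNReal.toReal_mul])
  have hcomp : (⋂ e, (A e)ᶜ).Nonempty := by
    apply CompactSpace.iInter_nonempty
    · intro e
      rw [isClosed_compl_iff]
      simp only [A]
      apply isOpen_lt continuous_const
      refine (Continuous.sub (continuous_finsetSum _ fun u _ => ?_) continuous_const).abs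
      exact (continuous_of_discreteTopology
        (f := fun x : Fin t => if x = e.2.2 then (1 : ℝ) else 0)).comp (continuous_apply u)
    · intro S
      by_contra h
      rw [Set.not_nonempty_iff_eq_empty] at h
      have := hlll S
      rw [h] at this
      simp at this
  obtain ⟨f, hf⟩ := hcomp
  refine ⟨f, fun v b c => ?_⟩
  have := Set.mem_iInter.mp hf (v, b, c)
  simpa [A] using this

theorem weights_facts (s k : ℕ) (hk : 1 ≤ k) (q : Fin (s + 1) → ℝ)
    (hq : ∀ c, q c = (1 - (6 * (k : ℝ))⁻¹) / (1 - (6 * (k : ℝ)) ^ (-((s + 1 : ℕ) : ℤ))) *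
      (6 * (k : ℝ)) ^ (((c.val + 1 : ℕ) : ℤ) - ((s + 1 : ℕ) : ℤ))) :
    (∀ c, 1 / (2 * (6 * (k : ℝ)) ^ s) ≤ q c) ∧ ∑ c, q c = 1 := by
  have hk' : (1 : ℝ) ≤ k := by exact_mod_cast hk
  set r : ℝ := 6 * k with hr
  have hr6 : 6 ≤ r := by linarith
  have hr0 : 0 < r := by linarith
  have hrt : 1 < r ^ (s + 1) := one_lt_pow₀ (by linarith) (by omega)
  have hz : r ^ (-((s + 1 : ℕ) : ℤ)) = (r ^ (s + 1))⁻¹ := by rw [zpow_neg, zpow_natCast]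
  have hzc : ∀ c : Fin (s + 1), r ^ (((c.val + 1 : ℕ) : ℤ) - ((s + 1 : ℕ) : ℤ)) =
      r ^ c.val / r ^ s := by
    intro c
    rw [zpow_sub₀ hr0.ne', zpow_natCast, zpow_natCast, pow_succ, pow_succ]
    field_simp
  simp only [hz, hzc] at hq
  have hinv : r⁻¹ ≤ 1 / 2 := by
    rw [inv_le_comm₀ hr0 (by norm_num)]; linarith
  have hinv2 : (r ^ (s + 1))⁻¹ < 1 := inv_lt_one_of_one_lt₀ hrt
  have hinv3 : 0 < (r ^ (s + 1))⁻¹ := by positivity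
  constructor
  · intro c
    rw [hq]
    have h1 : 1 / 2 ≤ (1 - r⁻¹) / (1 - (r ^ (s + 1))⁻¹) := by
      rw [le_div_iff₀ (by linarith)]; linarith
    have h2 : 1 / r ^ s ≤ r ^ c.val / r ^ s := by
      gcongr; exact one_le_pow₀ (by linarith)
    calc 1 / (2 * r ^ s) = 1 / 2 * (1 / r ^ s) := by field_simp
      _ ≤ _ := by gcongr
  · simp only [hq]
    rw [← Finset.mul_sum, ← Finset.sum_div, Fin.sum_univ_eq_sum_range (fun i => r ^ i),
      geom_sum_eq (by linarith)]
    have a1 : r - 1 ≠ 0 := by linarith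
    have a2 : r ^ (s + 1) - 1 ≠ 0 := by linarith
    have a3 : 1 - (r ^ (s + 1))⁻¹ ≠ 0 := by linarith
    have e1 : 1 - r⁻¹ = (r - 1) / r := by field_simp
    have e2 : 1 - (r ^ (s + 1))⁻¹ = (r ^ (s + 1) - 1) / r ^ (s + 1) := by field_simp
    rw [e1, e2]
    generalize hX : r ^ (s + 1) - 1 = X at *
    rw [pow_succ]
    field_simp

theorem large_k (s : ℕ) : ∃ k₀ : ℕ, ∀ k : ℕ, k₀ ≤ k → 1 ≤ k ∧
    16 * ((s + 1 : ℕ) : ℝ) * (k : ℝ) ^ (4 * (s + 1)) *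
      Real.exp (-((k : ℝ) / (8 * 36 ^ s))) ≤ 1 := by
  set a : ℝ := 1 / (8 * 36 ^ s) with ha
  have ha0 : 0 < a := by positivity
  have h1 : Filter.Tendsto (fun k : ℕ => a * (k : ℝ)) Filter.atTop Filter.atTop :=
    tendsto_natCast_atTop_atTop.const_mul_atTop ha0
  have h2 := (Real.tendsto_pow_mul_exp_neg_atTop_nhds_zero (4 * (s + 1))).comp h1
  have h3 : 0 < a ^ (4 * (s + 1)) / (16 * ((s + 1 : ℕ) : ℝ)) := by positivity
  have h4 := (h2.eventually (gt_mem_nhds h3)).and (Filter.eventually_ge_atTop 1)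
  obtain ⟨k₀, hk₀⟩ := Filter.eventually_atTop.mp h4
  refine ⟨k₀, fun k hk => ?_⟩
  obtain ⟨h5, h6⟩ := hk₀ k hk
  refine ⟨h6, ?_⟩
  simp only [Function.comp] at h5
  rw [lt_div_iff₀ (by positivity), mul_pow] at h5
  have e : (k : ℝ) / (8 * 36 ^ s) = a * k := by rw [ha]; ring
  rw [e]
  have h7 : 0 < a ^ (4 * (s + 1)) := by positivity
  refine le_of_mul_le_mul_left ?_ h7
  rw [mul_one]
  refine le_trans (le_of_eq ?_) h5.le
  ring

/-- For `k` sufficiently large as a function of `t`, with `d = k^{2t}` and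
`p_i = ((1 - (6k)⁻¹)/(1 - (6k)^{-t}))·(6k)^{i-t}`, every `d`-regular digraph
`D` admits a partition `(V_1, …, V_t)` of its vertex set such that every
vertex has at least `p_i·d/2` out-neighbours and at most `3·p_i·d/2`
in-neighbours in each `V_i`. -/
theorem regular_partition_claim :
    ∀ t : ℕ, 1 ≤ t → ∃ k₀ : ℕ, ∀ k : ℕ, k₀ ≤ k →
      ∀ (α : Type) (D : Digraph' α), IsRegularDigraph D (k ^ (2 * t)) →
        ∃ P : ℕ → Set α,
          (∀ i j : ℕ, 1 ≤ i → i ≤ t → 1 ≤ j → j ≤ t → i ≠ j →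
            Disjoint (P i) (P j)) ∧
          (⋃ i ∈ Finset.Icc 1 t, P i) = D.verts ∧
          ∀ v ∈ D.verts, ∀ i : ℕ, 1 ≤ i → i ≤ t →
            (((1 - (6 * (k : ℝ))⁻¹) / (1 - (6 * (k : ℝ)) ^ (-(t : ℤ))) *
                (6 * (k : ℝ)) ^ ((i : ℤ) - (t : ℤ))) * (k : ℝ) ^ (2 * t) / 2 ≤
              ({u | u ∈ P i ∧ D.Adj v u}.ncard : ℝ)) ∧
            (({u | u ∈ P i ∧ D.Adj u v}.ncard : ℝ) ≤
              3 * ((1 - (6 * (k : ℝ))⁻¹) / (1 - (6 * (k : ℝ)) ^ (-(t : ℤ))) *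
                (6 * (k : ℝ)) ^ ((i : ℤ) - (t : ℤ))) * (k : ℝ) ^ (2 * t) / 2) := by
  intro t ht
  obtain ⟨s, rfl⟩ : ∃ s, t = s + 1 := ⟨t - 1, by omega⟩
  obtain ⟨k₀, hk₀⟩ := large_k s
  refine ⟨k₀, fun k hk α D hD => ?_⟩
  obtain ⟨hk1, hkb⟩ := hk₀ k hk
  classical
  have hk1' : (1 : ℝ) ≤ k := by exact_mod_cast hk1
  let q : Fin (s + 1) → ℝ := fun c =>
    (1 - (6 * (k : ℝ))⁻¹) / (1 - (6 * (k : ℝ)) ^ (-((s + 1 : ℕ) : ℤ))) *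
      (6 * (k : ℝ)) ^ (((c.val + 1 : ℕ) : ℤ) - ((s + 1 : ℕ) : ℤ))
  obtain ⟨hqlow, hqsum⟩ := weights_facts s k hk1 q (fun _ => rfl)
  have hqpos : ∀ c, 0 < q c := fun c => lt_of_lt_of_le (by positivity) (hqlow c)
  let M : α → Bool → Set α := fun v b => if b then D.outNbrs v else D.inNbrs v
  have hM0 : ∀ v, v ∉ D.verts → ∀ b, M v b = ∅ := by
    intro v hv b
    ext u
    cases b
    · simpa [M, inNbrs] using fun h => hv (D.mem_verts_right h)
    · simpa [M, outNbrs] using fun h => hv (D.mem_verts_left h)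
  have hM1 : ∀ v, v ∈ D.verts → ∀ b, (M v b).Finite ∧ (M v b).ncard = k ^ (2 * (s + 1)) := by
    intro v hv b
    cases b
    · simpa [M] using (hD v hv).2
    · simpa [M] using (hD v hv).1
  have hMf : ∀ v b, (M v b).Finite := by
    intro v b
    by_cases hv : v ∈ D.verts
    · exact (hM1 v hv b).1
    · rw [hM0 v hv]; exact Set.finite_empty
  let N : α → Bool → Finset α := fun v b => (hMf v b).toFinset
  have hNcard : ∀ v ∈ D.verts, ∀ b, (N v b).card = k ^ (2 * (s + 1)) := by
    intro v hv b
    rw [← (hM1 v hv b).2, Set.ncard_eq_toFinset_card _ (hMf v b)]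
  have hNle : ∀ v b, (N v b).card ≤ k ^ (2 * (s + 1)) := by
    intro v b
    by_cases hv : v ∈ D.verts
    · exact (hNcard v hv b).le
    · simp [N, hM0 v hv b]
  have hsym : ∀ u v b, u ∈ N v b → v ∈ N u (!b) := by
    intro u v b h
    cases b <;> simpa [N, M, inNbrs, outNbrs] using h
  have hexp0 : 0 < Real.exp (-((k : ℝ) / (8 * 36 ^ s))) := Real.exp_pos _
  obtain ⟨f, hf⟩ := core_coloring N hsym (k ^ (2 * (s + 1))) (by positivity) hNle q hqpos hqsum
    (2 * Real.exp (-((k : ℝ) / (8 * 36 ^ s)))) (by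
      intro c
      refine mul_le_mul_of_nonneg_left (Real.exp_le_exp.mpr (neg_le_neg ?_)) (by norm_num)
      have h1 : (1 / (2 * (6 * (k : ℝ)) ^ s)) ^ 2 ≤ q c ^ 2 := by
        gcongr; exact hqlow c
      have h2 : (1 / (2 * (6 * (k : ℝ)) ^ s)) ^ 2 * ((k ^ (2 * (s + 1)) : ℕ) : ℝ) / 2 =
          (k : ℝ) ^ 2 / (8 * 36 ^ s) := by
        have e36 : (36 : ℝ) ^ s = (6 ^ s) ^ 2 := by rw [← pow_mul, mul_comm, pow_mul]; norm_num
        rw [e36]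
        push_cast
        rw [mul_pow]
        field_simp
        ring
      calc (k : ℝ) / (8 * 36 ^ s) ≤ (k : ℝ) ^ 2 / (8 * 36 ^ s) := by gcongr; nlinarith
        _ = _ := h2.symm
        _ ≤ _ := by gcongr) (by
      refine le_trans (le_of_eq ?_) hkb
      push_cast
      ring) (by
      have h1 : (1 : ℝ) ≤ ((s + 1 : ℕ) : ℝ) := by exact_mod_cast ht
      have h2 : (1 : ℝ) ≤ (k : ℝ) ^ (4 * (s + 1)) := one_le_pow₀ hk1'
      have h3 : (1 : ℝ) ≤ ((s + 1 : ℕ) : ℝ) * (k : ℝ) ^ (4 * (s + 1)) := by nlinarith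
      have h4 := mul_le_mul_of_nonneg_right h3 hexp0.le
      nlinarith) (by positivity)
  refine ⟨fun i => {u | u ∈ D.verts ∧ (f u).val + 1 = i}, ?_, ?_, ?_⟩
  · intro i j _ _ _ _ hij
    rw [Set.disjoint_left]
    rintro u ⟨_, h1⟩ ⟨_, h2⟩
    exact hij (h1.symm.trans h2)
  · ext u
    simp only [Set.mem_iUnion, Finset.mem_Icc, Set.mem_ofPred_eq]
    constructor
    · rintro ⟨i, _, h, _⟩
      exact h
    · intro h
      exact ⟨(f u).val + 1, ⟨by omega, by have := (f u).isLt; omega⟩, h, rfl⟩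
  · intro v hv i hi1 hi2
    obtain ⟨j, rfl⟩ : ∃ j, i = j + 1 := ⟨i - 1, by omega⟩
    let c : Fin (s + 1) := ⟨j, by omega⟩
    have hcount : ∀ b, (∑ u ∈ N v b, if f u = c then (1 : ℝ) else 0) =
        ({u | (u ∈ D.verts ∧ (f u).val + 1 = j + 1) ∧ u ∈ M v b}.ncard : ℝ) := by
      intro b
      rw [Finset.sum_boole]
      congr 1
      rw [← Set.ncard_coe_finset]
      congr 1
      ext u
      have huv : u ∈ M v b → u ∈ D.verts := by
        cases b
        · intro h
          have h : D.Adj u v := by simpa [M, inNbrs] using h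
          exact D.mem_verts_left h
        · intro h
          have h : D.Adj v u := by simpa [M, outNbrs] using h
          exact D.mem_verts_right h
      simp only [N, c, Finset.coe_filter, Set.Finite.mem_toFinset, Set.mem_ofPred_eq, Fin.ext_iff,
        Nat.add_right_cancel_iff]
      tauto
    have ho := hf v true c
    have hi := hf v false c
    rw [hcount, hNcard v hv, abs_le] at ho hi
    have hqc : q c = (1 - (6 * (k : ℝ))⁻¹) / (1 - (6 * (k : ℝ)) ^ (-((s + 1 : ℕ) : ℤ))) *
      (6 * (k : ℝ)) ^ (((j + 1 : ℕ) : ℤ) - ((s + 1 : ℕ) : ℤ)) := rfl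
    rw [← hqc]
    have e1 : {u | u ∈ {u | u ∈ D.verts ∧ (f u).val + 1 = j + 1} ∧ D.Adj v u} =
      {u | (u ∈ D.verts ∧ (f u).val + 1 = j + 1) ∧ u ∈ M v true} := by
      ext u; simp [M, outNbrs]
    have e2 : {u | u ∈ {u | u ∈ D.verts ∧ (f u).val + 1 = j + 1} ∧ D.Adj u v} =
      {u | (u ∈ D.verts ∧ (f u).val + 1 = j + 1) ∧ u ∈ M v false} := by
      ext u; simp [M, inNbrs]
    rw [e1, e2]
    rw [Nat.cast_pow] at ho hi
    constructor
    · linarith [ho.1]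
    · linarith [hi.2]
end
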